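/- arXiv:1712.10199 — 3 statements merged into one kernel-verified Lean document; each statement's English description precedes it below -/
import Mathlib

section
/- A birth-death process X is asymptotically aperiodic if and only if the 2-step chain X^(2) is simple. -/
open MeasureTheory Filter Set ProbabilityTheory

/-- A discrete-time Markov chain on a state space `S`: a stochastic transition
matrix `P`, an initial distribution `init`, and the induced probability measure
`μ` on the path space `ℕ → S`, determined by its values on cylinder sets. -/
structure MarkovChain (S : Type) [MeasurableSpace S] where
  P : S → S → ℝ
  P_nonneg : ∀ i j, 0 ≤ P i j
  P_stochastic : ∀ i, HasSum (P i) 1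
  init : S → ℝ
  init_nonneg : ∀ i, 0 ≤ init i
  init_hasSum : HasSum init 1
  μ : Measure (ℕ → S)
  μ_prob : IsProbabilityMeasure μ
  μ_cylinder : ∀ (n : ℕ) (s : ℕ → S),
    μ {ω | ∀ k ≤ n, ω k = s k}
      = ENNReal.ofReal (init (s 0) * ∏ k ∈ Finset.range n, P (s k) (s (k + 1)))

namespace MarkovChain

variable {S : Type} [MeasurableSpace S]

open Classical in
/-- The `n`-step transition probabilities `P^n(i,j)`. -/
noncomputable def Pn (X : MarkovChain S) : ℕ → S → S → ℝ
  | 0, i, j => if i = j then 1 else 0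
  | n + 1, i, j => ∑' k : S, X.Pn n i k * X.P k j

/-- Irreducibility: every state can be reached from every state. -/
def Irreducible (X : MarkovChain S) : Prop := ∀ i j : S, ∃ n : ℕ, 0 < X.Pn n i j

/-- Aperiodicity: for each state, the gcd of the set `{n ≥ 1 | P^n(i,i) > 0}`
is `1` (expressed via common divisors). -/
def Aperiodic (X : MarkovChain S) : Prop :=
  ∀ i : S, ∀ d : ℕ, (∀ n : ℕ, 0 < n → 0 < X.Pn n i i → d ∣ n) → d = 1

/-- `U^(m)(C)`: the event that the `m`-step chain visits `C` infinitely often. -/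
def U (X : MarkovChain S) (m : ℕ) (C : Set S) : Set (ℕ → S) :=
  {ω | ∀ n : ℕ, ∃ k : ℕ, n ≤ k ∧ ω (k * m) ∈ C}

/-- `L^(m)(C)`: the event that the `m`-step chain is eventually in `C`. -/
def L (X : MarkovChain S) (m : ℕ) (C : Set S) : Set (ℕ → S) :=
  {ω | ∃ n : ℕ, ∀ k : ℕ, n ≤ k → ω (k * m) ∈ C}

/-- `C` is transient with respect to the `m`-step chain `X^(m)`. -/
def Transient (X : MarkovChain S) (m : ℕ) (C : Set S) : Prop := X.μ (X.U m C) = 0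

/-- `C` is regular with respect to `X^(m)`: `U^(m)(C)` and `L^(m)(C)` agree up
to a null event. -/
def Regular (X : MarkovChain S) (m : ℕ) (C : Set S) : Prop :=
  X.μ (symmDiff (X.U m C) (X.L m C)) = 0

/-- `C` is almost closed with respect to `X^(m)`: regular but not transient. -/
def AlmostClosed (X : MarkovChain S) (m : ℕ) (C : Set S) : Prop :=
  X.Regular m C ∧ ¬ X.Transient m C

/-- An almost closed set is atomic if it does not contain two disjoint almost
closed subsets. -/
def Atomic (X : MarkovChain S) (m : ℕ) (C : Set S) : Prop :=
  X.AlmostClosed m C ∧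
    ¬ ∃ A B : Set S, A ⊆ C ∧ B ⊆ C ∧ Disjoint A B ∧
      X.AlmostClosed m A ∧ X.AlmostClosed m B

/-- A Blackwell decomposition for the `m`-step chain `X^(m)`: a countable
collection of pairwise disjoint almost closed sets, all atomic except at most
one, where a nonatomic member contains no atomic subsets and consists of
transient states, and such that the probabilities `μ(L^(m)(C))` sum to one. -/
structure IsBlackwell (X : MarkovChain S) (m : ℕ) (𝒞 : Set (Set S)) : Prop where
  countable : 𝒞.Countable
  almostClosed : ∀ C ∈ 𝒞, X.AlmostClosed m C
  disjoint : 𝒞.PairwiseDisjoint id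
  atMostOneNonatomic : ∀ C₁ ∈ 𝒞, ∀ C₂ ∈ 𝒞, ¬ X.Atomic m C₁ → ¬ X.Atomic m C₂ → C₁ = C₂
  nonatomicNoAtomicSubset : ∀ C ∈ 𝒞, ¬ X.Atomic m C → ∀ A : Set S, A ⊆ C → ¬ X.Atomic m A
  nonatomicTransientStates : ∀ C ∈ 𝒞, ¬ X.Atomic m C → ∀ i ∈ C, X.Transient m {i}
  sum_L_eq_one : ∑' C : 𝒞, X.μ (X.L m (C : Set S)) = 1

/-- `β(X^(m))`: the number of sets in a Blackwell decomposition for `X^(m)`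
(well defined since the decomposition is unique up to equivalence). -/
noncomputable def beta (X : MarkovChain S) (m : ℕ) : ℕ∞ :=
  sInf (Set.encard '' {𝒞 : Set (Set S) | X.IsBlackwell m 𝒞})

/-- `X` is simple if `β(X) = 1`. -/
def Simple (X : MarkovChain S) : Prop := X.beta 1 = 1

/-- The asymptotic period `d(X) = sup {m ≥ 1 | β(X^(m)) = m}` (possibly `∞`). -/
noncomputable def period (X : MarkovChain S) : ℕ∞ :=
  sSup {d : ℕ∞ | ∃ m : ℕ, 1 ≤ m ∧ X.beta m = (m : ℕ∞) ∧ d = (m : ℕ∞)}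

/-- Recurrence: every state is visited infinitely often almost surely. -/
def Recurrent (X : MarkovChain S) : Prop := ∀ i : S, X.μ (X.U 1 {i}) = 1

end MarkovChain

/-- The shift operator `θ` on path space: `(θ ω)(n) = ω(n+1)`. -/
def pathShift {S : Type} : (ℕ → S) → ℕ → S := fun ω n => ω (n + 1)

/-- An event `E` is `m`-invariant if its indicator function `f` satisfies
`f(ω) = f(θ^m ω)` for all paths `ω`. -/
def MInvariant {S : Type} (m : ℕ) (E : Set (ℕ → S)) : Prop :=
  ∀ ω : ℕ → S, ω ∈ E ↔ pathShift^[m] ω ∈ E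

/-- A birth-death process: a Markov chain on `ℕ` with positive birth
probabilities `p_i = P(i,i+1)`, positive death probabilities `q_{i+1} = P(i+1,i)`,
all transition probabilities other than `p_i`, `q_i` and `r_i = P(i,i)` zero,
and at least one positive self-transition probability. -/
structure MarkovChain.IsBirthDeath (X : MarkovChain ℕ) : Prop where
  birth_pos : ∀ i : ℕ, 0 < X.P i (i + 1)
  death_pos : ∀ i : ℕ, 0 < X.P (i + 1) i
  tridiagonal : ∀ i j : ℕ, 1 < |(i : ℤ) - (j : ℤ)| → X.P i j = 0
  self_pos : ∃ i : ℕ, 0 < X.P i i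

section PathSpace

variable {S : Type}

/-- The cylinder of paths that agree with `ω` up to time `n`. -/
def cylinderUpTo (n : ℕ) (ω : ℕ → S) : Set (ℕ → S) := {η | ∀ k ≤ n, η k = ω k}

/-- The path seen from time `n` on. -/
def shiftBy (n : ℕ) (ω : ℕ → S) : ℕ → S := fun k => ω (n + k)

lemma measurable_shiftBy [MeasurableSpace S] (n : ℕ) : Measurable (shiftBy n : (ℕ → S) → ℕ → S) :=
  measurable_pi_lambda _ fun _ => measurable_pi_apply _

lemma cylinderUpTo_congr {n : ℕ} {ω η : ℕ → S} (h : η ∈ cylinderUpTo n ω) :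
    cylinderUpTo n η = cylinderUpTo n ω := by
  ext ξ
  exact ⟨fun hξ k hk => (hξ k hk).trans (h k hk), fun hξ k hk => (hξ k hk).trans (h k hk).symm⟩

variable [MeasurableSpace S] [Countable S] [MeasurableSingletonClass S]

lemma measurableSet_piLE_of_cylinderUpTo_subset {n : ℕ} {T : Set (ℕ → S)}
    (h : ∀ ω ∈ T, cylinderUpTo n ω ⊆ T) :
    MeasurableSet[Filtration.piLE (X := fun _ : ℕ => S) n] T := by
  refine ⟨Preorder.restrictLe n '' T, (Set.to_countable _).measurableSet, ?_⟩
  ext ω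
  constructor
  · rintro ⟨η, hη, he⟩
    exact h η hη fun k hk => (congrFun he ⟨k, hk⟩).symm
  · exact fun hω => ⟨ω, hω, rfl⟩

lemma measurableSet_piLE_cylinderUpTo (n : ℕ) (ω : ℕ → S) :
    MeasurableSet[Filtration.piLE (X := fun _ : ℕ => S) n] (cylinderUpTo n ω) :=
  measurableSet_piLE_of_cylinderUpTo_subset fun _ hη => (cylinderUpTo_congr hη).le

lemma measurableSet_cylinderUpTo (n : ℕ) (ω : ℕ → S) : MeasurableSet (cylinderUpTo n ω) :=
  (Filtration.piLE (X := fun _ : ℕ => S)).le n _ (measurableSet_piLE_cylinderUpTo n ω)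

/-- Measures that agree on the cylinders of length `n` agree on all events
determined by the path up to time `n`. -/
lemma measure_eq_of_cylinderUpTo {μ ν : Measure (ℕ → S)} {n : ℕ}
    (h : ∀ ω, μ (cylinderUpTo n ω) = ν (cylinderUpTo n ω)) {T : Set (ℕ → S)}
    (hT : MeasurableSet[Filtration.piLE (X := fun _ : ℕ => S) n] T) : μ T = ν T := by
  obtain ⟨B, hB, rfl⟩ := hT
  have hm : Measurable (Preorder.restrictLe (π := fun _ : ℕ => S) n) :=
    Preorder.measurable_restrictLe n
  have key : μ.map (Preorder.restrictLe (π := fun _ : ℕ => S) n)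
      = ν.map (Preorder.restrictLe (π := fun _ : ℕ => S) n) := by
    refine Measure.ext_of_singleton fun b => ?_
    rw [Measure.map_apply hm (measurableSet_singleton b),
      Measure.map_apply hm (measurableSet_singleton b)]
    have : Preorder.restrictLe (π := fun _ : ℕ => S) n ⁻¹' {b}
        = cylinderUpTo n fun k => b ⟨min k n, min_le_right k n⟩ := by
      ext ω
      simp only [mem_preimage, mem_singleton_iff, cylinderUpTo, mem_ofPred_eq]
      constructor
      · rintro rfl k hk
        simp [min_eq_left hk]
      · intro hω
        ext ⟨k, hk⟩
        have hk' : k ≤ n := hk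
        simp [hω k hk', min_eq_left hk']
    rw [this, h]
  rw [← Measure.map_apply hm hB, key, Measure.map_apply hm hB]

lemma generateFrom_piLE :
    (MeasurableSpace.pi : MeasurableSpace (ℕ → S)) = MeasurableSpace.generateFrom
      {T | ∃ n, MeasurableSet[Filtration.piLE (X := fun _ : ℕ => S) n] T} := by
  refine le_antisymm (iSup_le fun n => ?_) (MeasurableSpace.generateFrom_le ?_)
  · rintro _ ⟨B, -, rfl⟩
    refine MeasurableSpace.measurableSet_generateFrom ⟨n, ?_⟩
    refine measurableSet_piLE_of_cylinderUpTo_subset fun ω hω η hη => ?_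
    simpa [hη n le_rfl] using hω
  · rintro T ⟨n, hT⟩
    exact (Filtration.piLE (X := fun _ : ℕ => S)).le n _ hT

lemma iSup_piLE :
    ⨆ n, (Filtration.piLE (X := fun _ : ℕ => S) n) = MeasurableSpace.pi := by
  refine le_antisymm (iSup_le fun n => Filtration.le _ n) ?_
  refine generateFrom_piLE.le.trans (MeasurableSpace.generateFrom_le ?_)
  rintro T ⟨n, hT⟩
  exact le_iSup (fun n => (Filtration.piLE (X := fun _ : ℕ => S) n)) n _ hT

/-- Finite measures on path space are determined by the cylinders. -/
lemma measure_ext_of_cylinderUpTo {μ ν : Measure (ℕ → S)} [IsFiniteMeasure μ]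
    (h : ∀ n ω, μ (cylinderUpTo n ω) = ν (cylinderUpTo n ω)) : μ = ν := by
  refine ext_of_generate_finite _ generateFrom_piLE ?_ ?_ ?_
  · rintro A ⟨a, hA⟩ B ⟨b, hB⟩ -
    have hmono := (Filtration.piLE (X := fun _ : ℕ => S)).mono'
    exact ⟨max a b, (hmono (le_max_left a b) _ hA).inter (hmono (le_max_right a b) _ hB)⟩
  · rintro T ⟨n, hT⟩
    exact measure_eq_of_cylinderUpTo (h n) hT
  · exact measure_eq_of_cylinderUpTo (h 0) MeasurableSet.univ

/-- Almost every path charges all the cylinders around it. -/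
lemma ae_measure_cylinderUpTo_ne_zero (μ : Measure (ℕ → S)) :
    ∀ᵐ ω ∂μ, ∀ n, μ (cylinderUpTo n ω) ≠ 0 := by
  refine ae_all_iff.2 fun n => ?_
  have hT : MeasurableSet[Filtration.piLE (X := fun _ : ℕ => S) n]
      {ω | μ (cylinderUpTo n ω) = 0} :=
    measurableSet_piLE_of_cylinderUpTo_subset fun ω hω η hη => by
      simpa [cylinderUpTo_congr hη] using hω
  have := measure_eq_of_cylinderUpTo
    (μ := μ.restrict {ω | μ (cylinderUpTo n ω) = 0}) (ν := 0) (n := n) (fun ω => ?_) hT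
  · rw [ae_iff]
    simpa using this
  · rw [Measure.restrict_apply (measurableSet_cylinderUpTo n ω)]
    by_cases hω : μ (cylinderUpTo n ω) = 0
    · exact measure_mono_null inter_subset_left hω
    · have : cylinderUpTo n ω ∩ {ω | μ (cylinderUpTo n ω) = 0} = ∅ := by
        ext η
        simp only [mem_inter_iff, mem_ofPred_eq, mem_empty_iff_false, iff_false, not_and]
        intro hη
        rwa [cylinderUpTo_congr hη]
      simp [this]

/-- Lévy's zero-one law for the cylinder filtration: the conditional probability of an
event given the path up to time `n` tends to the indicator of the event. -/
lemma ae_tendsto_cylinderUpTo_ratio (μ : Measure (ℕ → S)) [IsProbabilityMeasure μ]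
    {V : Set (ℕ → S)} (hV : MeasurableSet V) :
    ∀ᵐ ω ∂μ, Tendsto
      (fun n => (μ (cylinderUpTo n ω ∩ V) / μ (cylinderUpTo n ω)).toReal) atTop
      (nhds (V.indicator 1 ω)) := by
  set ρ : ℕ → (ℕ → S) → ENNReal :=
    fun n ω => μ (cylinderUpTo n ω ∩ V) / μ (cylinderUpTo n ω) with hρ
  have hρle : ∀ n ω, ρ n ω ≤ 1 := fun n ω =>
    ENNReal.div_le_of_le_mul (by simpa using measure_mono inter_subset_left)
  have hcongr : ∀ n ω η, η ∈ cylinderUpTo n ω → ρ n η = ρ n ω := fun n ω η h => by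
    simp only [hρ, cylinderUpTo_congr h]
  have hmeas : ∀ n, Measurable[Filtration.piLE (X := fun _ : ℕ => S) n] (ρ n) := fun n B _ =>
    measurableSet_piLE_of_cylinderUpTo_subset fun ω hω η hη => by
      simpa [hcongr n ω η hη] using hω
  have hmeas' : ∀ n, Measurable (ρ n) := fun n => (hmeas n).mono (Filtration.le _ n) le_rfl
  have hdens : ∀ n, ∀ T, MeasurableSet[Filtration.piLE (X := fun _ : ℕ => S) n] T →
      ∫⁻ ω in T, ρ n ω ∂μ = μ (T ∩ V) := by
    intro n T hT
    have hT' : MeasurableSet T := Filtration.le _ n _ hT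
    rw [← withDensity_apply _ hT', ← Measure.restrict_apply hT']
    refine measure_eq_of_cylinderUpTo (fun ω => ?_) hT
    have hc := measurableSet_cylinderUpTo n ω
    rw [withDensity_apply _ hc, Measure.restrict_apply hc,
      setLIntegral_congr_fun hc (g := fun _ => ρ n ω) (fun η hη => hcongr n ω η hη),
      setLIntegral_const]
    by_cases h0 : μ (cylinderUpTo n ω) = 0
    · rw [h0, mul_zero, measure_mono_null inter_subset_left h0]
    · exact ENNReal.div_mul_cancel h0 (measure_ne_top _ _)
  have hcond : ∀ n, (fun ω => (ρ n ω).toReal) =ᵐ[μ]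
      μ[V.indicator (1 : (ℕ → S) → ℝ) | Filtration.piLE (X := fun _ : ℕ => S) n] := by
    intro n
    have hint : Integrable (fun ω => (ρ n ω).toReal) μ := by
      refine Integrable.of_bound (C := 1) (hmeas' n).ennreal_toReal.aestronglyMeasurable ?_
      refine ae_of_all _ fun ω => ?_
      rw [Real.norm_of_nonneg ENNReal.toReal_nonneg]
      exact ENNReal.toReal_le_of_le_ofReal zero_le_one (by simpa using hρle n ω)
    refine ae_eq_condExp_of_forall_setIntegral_eq (Filtration.le _ n)
      ((integrable_const (1 : ℝ)).indicator hV) (fun _ _ _ => hint.integrableOn)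
      (fun T hT _ => ?_) ?_
    · have hT' : MeasurableSet T := Filtration.le _ n _ hT
      rw [integral_toReal (hmeas' n).aemeasurable
        (ae_of_all _ fun ω => (hρle n ω).trans_lt ENNReal.one_lt_top), hdens n T hT,
        integral_indicator_one hV, measureReal_restrict_apply hV, inter_comm]
      rfl
    · exact (hmeas n).ennreal_toReal.aestronglyMeasurable
  have hlim := tendsto_ae_condExp (μ := μ) (ℱ := Filtration.piLE (X := fun _ : ℕ => S))
    (V.indicator (1 : (ℕ → S) → ℝ))
  rw [iSup_piLE, condExp_of_stronglyMeasurable le_rfl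
    (stronglyMeasurable_one.indicator hV) ((integrable_const (1 : ℝ)).indicator hV)] at hlim
  filter_upwards [hlim, ae_all_iff.2 hcond] with ω h1 h2
  exact h1.congr fun n => (h2 n).symm

end PathSpace

namespace MarkovChain

section Restart

variable {S : Type} [MeasurableSpace S] (X : MarkovChain S)

instance : IsProbabilityMeasure X.μ := X.μ_prob

lemma measure_cylinderUpTo (n : ℕ) (ω : ℕ → S) :
    X.μ (cylinderUpTo n ω)
      = ENNReal.ofReal (X.init (ω 0) * ∏ k ∈ Finset.range n, X.P (ω k) (ω (k + 1))) :=
  X.μ_cylinder n ω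

lemma measure_cylinderUpTo_succ (n : ℕ) (ω : ℕ → S) :
    X.μ (cylinderUpTo (n + 1) ω)
      = X.μ (cylinderUpTo n ω) * ENNReal.ofReal (X.P (ω n) (ω (n + 1))) := by
  rw [measure_cylinderUpTo, measure_cylinderUpTo, Finset.prod_range_succ, ← mul_assoc,
    ENNReal.ofReal_mul (mul_nonneg (X.init_nonneg _) (Finset.prod_nonneg fun _ _ => X.P_nonneg _ _))]

/-- The state `x` is charged by the chain at some time. -/
def Accessible (x : S) : Prop :=
  ∃ (n : ℕ) (ω : ℕ → S), X.μ (cylinderUpTo n ω) ≠ 0 ∧ ω n = x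

/-- The law of the chain after time `n`, given that it follows `ω` up to time `n`. -/
noncomputable def restart (n : ℕ) (ω : ℕ → S) : Measure (ℕ → S) :=
  (cond X.μ (cylinderUpTo n ω)).map (shiftBy n)

open Classical in
/-- The law of the chain started at the (accessible) state `x`. -/
noncomputable def startAt (x : S) : Measure (ℕ → S) :=
  if h : X.Accessible x then X.restart h.choose h.choose_spec.choose else 0

lemma accessible_of_cylinderUpTo {n : ℕ} {ω : ℕ → S} (h : X.μ (cylinderUpTo n ω) ≠ 0) :
    X.Accessible (ω n) :=
  ⟨n, ω, h, rfl⟩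

lemma exists_accessible : ∃ x, X.Accessible x := by
  obtain ⟨x, hx⟩ : ∃ x, X.init x ≠ 0 := by
    by_contra! h
    exact zero_ne_one ((funext h ▸ hasSum_zero : HasSum X.init 0).unique X.init_hasSum)
  refine ⟨x, 0, fun _ => x, ?_, rfl⟩
  simpa [measure_cylinderUpTo] using (X.init_nonneg x).lt_of_ne hx.symm

variable {X} in
lemma Accessible.exists_step {x y : S} (hx : X.Accessible x) (hxy : 0 < X.P x y) :
    ∃ (n : ℕ) (ω : ℕ → S), X.μ (cylinderUpTo (n + 1) ω) ≠ 0 ∧ ω n = x ∧ ω (n + 1) = y := by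
  classical
  obtain ⟨n, ω, h, rfl⟩ := hx
  have hcyl : cylinderUpTo n (Function.update ω (n + 1) y) = cylinderUpTo n ω :=
    cylinderUpTo_congr fun k hk => Function.update_of_ne (by omega) _ _
  refine ⟨n, Function.update ω (n + 1) y, ?_, by simp, by simp⟩
  rw [measure_cylinderUpTo_succ, hcyl]
  refine mul_ne_zero h ?_
  simpa using hxy

variable {X} in
lemma Accessible.step {x y : S} (hx : X.Accessible x) (hxy : 0 < X.P x y) :
    X.Accessible y := by
  obtain ⟨n, ω, h, -, rfl⟩ := hx.exists_step hxy
  exact X.accessible_of_cylinderUpTo h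

open Classical in
lemma measure_cylinderUpTo_inter_shiftBy (n N : ℕ) (ω η : ℕ → S) :
    X.μ (cylinderUpTo n ω ∩ shiftBy n ⁻¹' cylinderUpTo N η)
      = X.μ (cylinderUpTo n ω) * if η 0 = ω n
        then ENNReal.ofReal (∏ k ∈ Finset.range N, X.P (η k) (η (k + 1))) else 0 := by
  split_ifs with h
  · set ξ : ℕ → S := fun k => if k ≤ n then ω k else η (k - n) with hξ
    have hξω : ∀ k ≤ n, ξ k = ω k := fun k hk => by simp [hξ, hk]
    have hξη : ∀ k, ξ (n + k) = η k := by
      rintro (_ | k)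
      · simp [hξ, h]
      · simp [hξ]
    have hset : cylinderUpTo n ω ∩ shiftBy n ⁻¹' cylinderUpTo N η = cylinderUpTo (n + N) ξ := by
      ext ζ
      constructor
      · rintro ⟨h1, h2⟩ k hk
        rcases le_or_gt k n with hkn | hkn
        · rw [hξω k hkn, h1 k hkn]
        · obtain ⟨j, rfl⟩ := Nat.exists_eq_add_of_le hkn.le
          rw [hξη]
          exact h2 j (by omega)
      · intro hζ
        refine ⟨fun k hk => ?_, fun k hk => ?_⟩
        · rw [hζ k (by omega), hξω k hk]
        · exact (hζ (n + k) (by omega)).trans (hξη k)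
    have h1 : ∏ k ∈ Finset.range n, X.P (ξ k) (ξ (k + 1))
        = ∏ k ∈ Finset.range n, X.P (ω k) (ω (k + 1)) :=
      Finset.prod_congr rfl fun k hk => by
        have := Finset.mem_range.1 hk
        rw [hξω k (by omega), hξω (k + 1) (by omega)]
    rw [hset, measure_cylinderUpTo, measure_cylinderUpTo, Finset.prod_range_add, h1,
      hξω 0 (Nat.zero_le _), ← mul_assoc, ENNReal.ofReal_mul
        (mul_nonneg (X.init_nonneg _) (Finset.prod_nonneg fun _ _ => X.P_nonneg _ _))]
    simp only [add_assoc, hξη]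
  · have : cylinderUpTo n ω ∩ shiftBy n ⁻¹' cylinderUpTo N η = ∅ := by
      refine eq_empty_of_forall_notMem ?_
      rintro ζ ⟨h1, h2⟩
      exact h ((h2 0 (Nat.zero_le _)).symm.trans (h1 n le_rfl))
    simp [this]

variable [Countable S] [MeasurableSingletonClass S]

lemma restart_apply (n : ℕ) (ω : ℕ → S) {F : Set (ℕ → S)} (hF : MeasurableSet F) :
    X.restart n ω F
      = X.μ (cylinderUpTo n ω ∩ shiftBy n ⁻¹' F) / X.μ (cylinderUpTo n ω) := by
  rw [restart, Measure.map_apply (measurable_shiftBy n) hF,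
    cond_apply (measurableSet_cylinderUpTo n ω), ENNReal.div_eq_inv_mul]

instance (n : ℕ) (ω : ℕ → S) : IsFiniteMeasure (X.restart n ω) := by
  unfold restart
  infer_instance

lemma restart_congr {n n' : ℕ} {ω ω' : ℕ → S} (h : X.μ (cylinderUpTo n ω) ≠ 0)
    (h' : X.μ (cylinderUpTo n' ω') ≠ 0) (he : ω n = ω' n') :
    X.restart n ω = X.restart n' ω' := by
  refine measure_ext_of_cylinderUpTo fun N η => ?_
  have hη := measurableSet_cylinderUpTo N η
  rw [restart_apply X n ω hη, restart_apply X n' ω' hη, measure_cylinderUpTo_inter_shiftBy,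
    measure_cylinderUpTo_inter_shiftBy, he, mul_comm, mul_comm (X.μ (cylinderUpTo n' ω')),
    ENNReal.mul_div_cancel_right h (measure_ne_top _ _),
    ENNReal.mul_div_cancel_right h' (measure_ne_top _ _)]

lemma startAt_eq_restart {n : ℕ} {ω : ℕ → S} (h : X.μ (cylinderUpTo n ω) ≠ 0) :
    X.startAt (ω n) = X.restart n ω := by
  have hacc := X.accessible_of_cylinderUpTo h
  rw [startAt, dif_pos hacc]
  exact X.restart_congr hacc.choose_spec.choose_spec.1 h hacc.choose_spec.choose_spec.2

/-- The Markov property. -/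
lemma startAt_apply {n : ℕ} {ω : ℕ → S} (h : X.μ (cylinderUpTo n ω) ≠ 0)
    {F : Set (ℕ → S)} (hF : MeasurableSet F) :
    X.startAt (ω n) F
      = X.μ (cylinderUpTo n ω ∩ shiftBy n ⁻¹' F) / X.μ (cylinderUpTo n ω) := by
  rw [startAt_eq_restart X h, restart_apply X n ω hF]

lemma startAt_apply_eq_zero_iff {n : ℕ} {ω : ℕ → S} (h : X.μ (cylinderUpTo n ω) ≠ 0)
    {F : Set (ℕ → S)} (hF : MeasurableSet F) :
    X.startAt (ω n) F = 0 ↔ X.μ (cylinderUpTo n ω ∩ shiftBy n ⁻¹' F) = 0 := by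
  simp [startAt_apply X h hF, measure_ne_top]

variable {X} in
lemma Accessible.isProbabilityMeasure {x : S} (hx : X.Accessible x) :
    IsProbabilityMeasure (X.startAt x) := by
  obtain ⟨n, ω, h, rfl⟩ := hx
  refine ⟨?_⟩
  rw [startAt_apply X h MeasurableSet.univ, preimage_univ, inter_univ,
    ENNReal.div_self h (measure_ne_top _ _)]

variable {X} in
lemma Accessible.startAt_ne {x : S} (hx : X.Accessible x) :
    X.startAt x {η | η 0 ≠ x} = 0 := by
  obtain ⟨n, ω, h, rfl⟩ := hx
  have hm : MeasurableSet {η : ℕ → S | η 0 ≠ ω n} :=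
    (measurableSet_singleton (ω n)).compl.preimage (measurable_pi_apply 0)
  rw [startAt_apply_eq_zero_iff X h hm]
  convert measure_empty (μ := X.μ)
  refine eq_empty_of_forall_notMem ?_
  rintro η ⟨h1, h2⟩
  exact h2 (h1 n le_rfl)

variable {X} in
lemma Accessible.startAt_eq_zero_of_step {x y : S} (hx : X.Accessible x) (hxy : 0 < X.P x y)
    {F : Set (ℕ → S)} (hF : MeasurableSet F) (h : X.startAt x (shiftBy 1 ⁻¹' F) = 0) :
    X.startAt y F = 0 := by
  obtain ⟨n, ω, hω, rfl, rfl⟩ := hx.exists_step hxy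
  have hω' : X.μ (cylinderUpTo n ω) ≠ 0 := fun h0 => hω (by
    rw [measure_cylinderUpTo_succ, h0, zero_mul])
  rw [startAt_apply_eq_zero_iff X hω' (measurable_shiftBy 1 hF)] at h
  rw [startAt_apply_eq_zero_iff X hω hF]
  refine measure_mono_null ?_ h
  rintro η ⟨h1, h2⟩
  refine ⟨fun k hk => h1 k (by omega), ?_⟩
  have : shiftBy 1 (shiftBy n η) = shiftBy (n + 1) η := by
    funext k
    simp [shiftBy, add_assoc]
  simpa [this] using h2

/-- Lévy's zero-one law along the chain. -/
lemma ae_tendsto_startAt {V : Set (ℕ → S)} {F : ℕ → Set (ℕ → S)}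
    (hF : ∀ n, MeasurableSet (F n)) (hVF : ∀ n, shiftBy n ⁻¹' F n = V) :
    ∀ᵐ ω ∂X.μ, Tendsto (fun n => (X.startAt (ω n) (F n)).toReal) atTop
      (nhds (V.indicator 1 ω)) := by
  have hV : MeasurableSet V := hVF 0 ▸ measurable_shiftBy 0 (hF 0)
  filter_upwards [ae_tendsto_cylinderUpTo_ratio X.μ hV, ae_measure_cylinderUpTo_ne_zero X.μ]
    with ω h1 h2
  refine h1.congr fun n => ?_
  rw [startAt_apply X (h2 n) (hF n), hVF n]

/-- Along a path that stays in `C` from some time on, the conditional probability of staying in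
`C` forever tends to one. -/
lemma ae_tendsto_startAt_stay (C : Set S) (N : ℕ) :
    ∀ᵐ ω ∂X.μ, (∀ n ≥ N, ω n ∈ C) →
      Tendsto (fun n => (X.startAt (ω n) {η | ∀ k, η k ∈ C}).toReal) atTop (nhds 1) := by
  have hF : MeasurableSet {η : ℕ → S | ∀ k, η k ∈ C} := by
    have : {η : ℕ → S | ∀ k, η k ∈ C} = ⋂ k, (fun η => η k) ⁻¹' C := by ext; simp
    rw [this]
    exact MeasurableSet.iInter fun k => measurable_pi_apply k (Set.to_countable C).measurableSet
  have hV := measurable_shiftBy N hF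
  filter_upwards [ae_tendsto_cylinderUpTo_ratio X.μ hV, ae_measure_cylinderUpTo_ne_zero X.μ]
    with ω h1 h2 h3
  have hωV : ω ∈ shiftBy N ⁻¹' {η : ℕ → S | ∀ k, η k ∈ C} := fun k => h3 _ (by omega)
  rw [indicator_of_mem hωV, Pi.one_apply] at h1
  refine h1.congr' ?_
  filter_upwards [eventually_ge_atTop N] with n hn
  rw [startAt_apply X (h2 n) hF]
  congr 3
  ext η
  refine and_congr_right fun hη => ⟨fun h k => ?_, fun h k => ?_⟩
  · have := h (n + k - N)
    simp only [shiftBy] at this ⊢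
    rwa [show N + (n + k - N) = n + k by omega] at this
  · rcases le_or_gt (N + k) n with hk | hk
    · simpa [shiftBy, hη _ hk] using h3 (N + k) (by omega)
    · have := h (N + k - n)
      simp only [shiftBy] at this ⊢
      rwa [show n + (N + k - n) = N + k by omega] at this

end Restart

end MarkovChain

/-- Unless it is bounded, a process that moves up by at most one visits every high level
arbitrarily late. -/
lemma exists_ge_eq_of_upward_skip_free {ω : ℕ → ℕ} (hstep : ∀ n, ω (n + 1) ≤ ω n + 1)
    (hunb : ∀ K N, ∃ n ≥ N, K < ω n) {N x : ℕ} (hx : ω N ≤ x) : ∃ n ≥ N, ω n = x := by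
  classical
  have hex : ∃ n, N ≤ n ∧ x ≤ ω n := by
    obtain ⟨n, hn, h⟩ := hunb x N
    exact ⟨n, hn, h.le⟩
  obtain ⟨h1, h2⟩ := Nat.find_spec hex
  refine ⟨Nat.find hex, h1, le_antisymm ?_ h2⟩
  rcases h1.eq_or_lt with h | h
  · rwa [← h]
  · have hmin := Nat.find_min hex (m := Nat.find hex - 1) (by omega)
    have := hstep (Nat.find hex - 1)
    rw [Nat.sub_add_cancel (by omega)] at this
    by_contra hlt
    exact hmin ⟨by omega, by omega⟩

/-- An eventually bounded sequence of natural numbers takes some value infinitely often. -/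
lemma exists_frequently_eq {ω : ℕ → ℕ} {K : ℕ} (h : ∀ᶠ n in atTop, ω n ≤ K) :
    ∃ x, ∃ᶠ n in atTop, ω n = x := by
  by_contra! hcon
  have : ∀ᶠ n in atTop, ∀ x ∈ Finset.Iic K, ω n ≠ x :=
    (Finset.eventually_all _).2 fun x _ => hcon x
  obtain ⟨n, h1, h2⟩ := (h.and this).exists
  exact h2 _ (Finset.mem_Iic.2 h1) rfl

/-- The event that the coordinates at the times congruent to `r` modulo `m` are eventually
in `C`. -/
def eventuallyIn {S : Type} (m : ℕ) (C : Set S) (r : ℕ) : Set (ℕ → S) :=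
  {ω | ∃ N, ∀ k ≥ N, ω (k * m + r) ∈ C}

lemma mem_eventuallyIn {S : Type} {m : ℕ} {C : Set S} {r : ℕ} {ω : ℕ → S} :
    ω ∈ eventuallyIn m C r ↔ ∀ᶠ k in atTop, ω (k * m + r) ∈ C :=
  eventually_atTop.symm

lemma shiftBy_preimage_eventuallyIn {S : Type} (m : ℕ) (C : Set S) (r n : ℕ) :
    shiftBy n ⁻¹' eventuallyIn m C r = eventuallyIn m C (r + n) := by
  ext ω
  simp only [mem_preimage, mem_eventuallyIn, shiftBy]
  simp only [add_comm n, add_assoc]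

lemma eventuallyIn_add_mul {S : Type} (m : ℕ) (C : Set S) (r n : ℕ) :
    eventuallyIn m C (r + n * m) = eventuallyIn m C r := by
  ext ω
  have hshift : (∀ᶠ k in atTop, ω ((k + n) * m + r) ∈ C) ↔ ∀ᶠ k in atTop, ω (k * m + r) ∈ C := by
    conv_rhs => rw [← map_add_atTop_eq_nat n]
    rfl
  rw [mem_eventuallyIn, mem_eventuallyIn, ← hshift]
  refine eventually_congr (Eventually.of_forall fun k => ?_)
  rw [show k * m + (r + n * m) = (k + n) * m + r by ring]

lemma eventuallyIn_mod (m : ℕ) {S : Type} (C : Set S) (r : ℕ) :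
    eventuallyIn m C (r % m) = eventuallyIn m C r := by
  conv_rhs => rw [← Nat.mod_add_div' r m]
  rw [eventuallyIn_add_mul]

lemma measurableSet_eventuallyIn {S : Type} [MeasurableSpace S] [Countable S]
    [MeasurableSingletonClass S] (m : ℕ) (C : Set S) (r : ℕ) :
    MeasurableSet (eventuallyIn m C r) := by
  have : eventuallyIn m C r = ⋃ N, ⋂ k ≥ N, (fun ω : ℕ → S => ω (k * m + r)) ⁻¹' C := by
    ext
    simp [eventuallyIn]
  rw [this]
  exact MeasurableSet.iUnion fun N => MeasurableSet.iInter fun k => MeasurableSet.iInter fun _ =>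
    measurable_pi_apply _ (Set.to_countable C).measurableSet

namespace MarkovChain

lemma L_eq_eventuallyIn {S : Type} [MeasurableSpace S] (X : MarkovChain S) (m : ℕ) (C : Set S) :
    X.L m C = eventuallyIn m C 0 := rfl

variable {X : MarkovChain ℕ}

namespace IsBirthDeath

lemma forall_of_step (hbd : X.IsBirthDeath) {Z : ℕ → Prop} (h0 : ∃ x, Z x)
    (hstep : ∀ x y, 0 < X.P x y → Z x → Z y) (y : ℕ) : Z y := by
  obtain ⟨x, hx⟩ := h0
  have hzero : Z 0 := by
    induction x with
    | zero => exact hx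
    | succ x ih => exact ih (hstep _ _ (hbd.death_pos x) hx)
  induction y with
  | zero => exact hzero
  | succ y ih => exact hstep _ _ (hbd.birth_pos y) ih

lemma accessible (hbd : X.IsBirthDeath) (x : ℕ) : X.Accessible x :=
  hbd.forall_of_step X.exists_accessible (fun _ _ hxy hx => hx.step hxy) x

lemma ae_step (hbd : X.IsBirthDeath) :
    ∀ᵐ ω ∂X.μ, ∀ n, ω (n + 1) ≤ ω n + 1 ∧ ω n ≤ ω (n + 1) + 1 := by
  filter_upwards [ae_measure_cylinderUpTo_ne_zero X.μ] with ω hω n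
  by_contra hcon
  refine hω (n + 1) ?_
  rw [measure_cylinderUpTo_succ, hbd.tridiagonal, ENNReal.ofReal_zero, mul_zero]
  rw [lt_abs]
  omega

lemma startAt_stay_Iic_ne_one (hbd : X.IsBirthDeath) (K x : ℕ) :
    X.startAt x {η | ∀ k, η k ≤ K} ≠ 1 := by
  set F : Set (ℕ → ℕ) := {η | ∀ k, η k ≤ K} with hFdef
  have hF : MeasurableSet F := by
    have : F = ⋂ k, (fun η => η k) ⁻¹' Iic K := by ext; simp [hFdef]
    rw [this]
    exact MeasurableSet.iInter fun k => measurable_pi_apply k (Set.to_countable _).measurableSet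
  intro h
  have hprob := fun x => (hbd.accessible x).isProbabilityMeasure
  have hnull : ∀ y, X.startAt y Fᶜ = 0 := by
    refine hbd.forall_of_step ⟨x, (prob_compl_eq_zero_iff hF).2 h⟩ fun y z hyz hy => ?_
    refine (hbd.accessible y).startAt_eq_zero_of_step hyz hF.compl (measure_mono_null ?_ hy)
    exact fun η hη hη' => hη fun k => hη' (1 + k)
  have h1 : X.startAt (K + 1) F = 0 := by
    refine measure_mono_null (fun η hη => ?_) (hbd.accessible (K + 1)).startAt_ne
    have := hη 0
    simp only [mem_ofPred_eq]
    omega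
  exact zero_ne_one (h1.symm.trans ((prob_compl_eq_zero_iff hF).1 (hnull (K + 1))))

lemma ae_unbounded (hbd : X.IsBirthDeath) : ∀ᵐ ω ∂X.μ, ∀ K N, ∃ n ≥ N, K < ω n := by
  refine ae_all_iff.2 fun K => ae_all_iff.2 fun N => ?_
  filter_upwards [X.ae_tendsto_startAt_stay (Iic K) N] with ω hω
  by_contra! hcon
  obtain ⟨x, hx⟩ := exists_frequently_eq (eventually_atTop.2 ⟨N, hcon⟩)
  have hprob := (hbd.accessible x).isProbabilityMeasure
  have hne : (X.startAt x {η | ∀ k, η k ∈ Iic K}).toReal ≠ 1 := by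
    rw [Ne, ENNReal.toReal_eq_one_iff]
    exact hbd.startAt_stay_Iic_ne_one K x
  obtain ⟨n, rfl, h2⟩ := (hx.and_eventually ((hω hcon).eventually_ne hne.symm)).exists
  exact h2 rfl

end IsBirthDeath

/-- Properties that almost all paths share: unit steps, unboundedness and the conclusion of
Lévy's zero-one law for the events `eventuallyIn m C r`. -/
structure TypicalPath (X : MarkovChain ℕ) (m : ℕ) (C : Set ℕ) (ω : ℕ → ℕ) : Prop where
  step : ∀ n, ω (n + 1) ≤ ω n + 1 ∧ ω n ≤ ω (n + 1) + 1
  unbounded : ∀ K N, ∃ n ≥ N, K < ω n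
  tendsto : ∀ r, Tendsto
    (fun n => (X.startAt (ω n) (eventuallyIn m C (r + n * (m - 1)))).toReal) atTop
    (nhds ((eventuallyIn m C r).indicator 1 ω))

lemma IsBirthDeath.ae_typicalPath (hbd : X.IsBirthDeath) {m : ℕ} (hm : 1 ≤ m) (C : Set ℕ) :
    ∀ᵐ ω ∂X.μ, X.TypicalPath m C ω := by
  have hlevy : ∀ᵐ ω ∂X.μ, ∀ r, Tendsto
      (fun n => (X.startAt (ω n) (eventuallyIn m C (r + n * (m - 1)))).toReal) atTop
      (nhds ((eventuallyIn m C r).indicator 1 ω)) := by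
    refine ae_all_iff.2 fun r => X.ae_tendsto_startAt
      (fun n => measurableSet_eventuallyIn m C _) fun n => ?_
    rw [shiftBy_preimage_eventuallyIn, ← eventuallyIn_add_mul m C r n]
    obtain ⟨j, rfl⟩ := Nat.exists_eq_add_of_le' hm
    congr 1
    simp only [Nat.add_sub_cancel]
    ring
  filter_upwards [hbd.ae_step, hbd.ae_unbounded, hlevy] with ω h1 h2 h3
  exact ⟨h1, h2, h3⟩

namespace TypicalPath

variable {m : ℕ} {C : Set ℕ} {ω η : ℕ → ℕ}

lemma exists_ge_eq (h : X.TypicalPath m C ω) {N x : ℕ} (hx : ω N ≤ x) : ∃ n ≥ N, ω n = x :=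
  exists_ge_eq_of_upward_skip_free (fun n => (h.step n).1) h.unbounded hx

lemma eventually_forall_abs_sub_lt (h : X.TypicalPath m C ω) (hm : 1 ≤ m) {ε : ℝ} (hε : 0 < ε) :
    ∀ᶠ n in atTop, ∀ r, |(X.startAt (ω n) (eventuallyIn m C (r + n * (m - 1)))).toReal
      - (eventuallyIn m C r).indicator 1 ω| < ε := by
  have hfin : ∀ᶠ n in atTop, ∀ r ∈ Finset.range m,
      |(X.startAt (ω n) (eventuallyIn m C (r + n * (m - 1)))).toReal
        - (eventuallyIn m C r).indicator 1 ω| < ε :=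
    (Finset.eventually_all _).2 fun r _ => by
      simpa [Real.dist_eq] using (Metric.tendsto_nhds.1 (h.tendsto r)) ε hε
  filter_upwards [hfin] with n hn r
  have := hn (r % m) (Finset.mem_range.2 (Nat.mod_lt _ hm))
  rwa [eventuallyIn_mod, ← eventuallyIn_mod m C (r % m + n * (m - 1)), Nat.mod_add_mod,
    eventuallyIn_mod] at this

end TypicalPath

lemma indicator_one_eq_of_abs_sub_lt {α β : Type} {A : Set α} {B : Set β} {a : α} {b : β}
    {t : ℝ} (h1 : |t - A.indicator 1 a| < 1 / 2) (h2 : |t - B.indicator 1 b| < 1 / 2) :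
    (a ∈ A ↔ b ∈ B) := by
  by_cases ha : a ∈ A <;> by_cases hb : b ∈ B <;> simp only [ha, hb, indicator_of_mem,
    indicator_of_notMem, not_false_eq_true, Pi.one_apply, iff_true, iff_false,
    not_true_eq_false] at h1 h2 ⊢
  all_goals (rw [abs_lt] at h1 h2; linarith [h1.1, h1.2, h2.1, h2.2])

lemma IsBirthDeath.startAt_eq_zero_of_shift (hbd : X.IsBirthDeath) {F : ℕ → Set (ℕ → ℕ)}
    (hF : ∀ r, MeasurableSet (F r)) (hshift : ∀ r, shiftBy 1 ⁻¹' F r = F (r + 1))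
    (h0 : ∃ x, ∀ r, X.startAt x (F r) = 0) (y r : ℕ) : X.startAt y (F r) = 0 :=
  hbd.forall_of_step (Z := fun x => ∀ r, X.startAt x (F r) = 0) h0
    (fun x _ hxy hx r => (hbd.accessible x).startAt_eq_zero_of_step hxy (hF r)
      (by rw [hshift]; exact hx (r + 1))) y r

namespace TypicalPath

variable {m : ℕ} {C : Set ℕ} {ω η : ℕ → ℕ}

lemma mem_eventuallyIn_iff_of_hold (hω : X.TypicalPath m C ω) (hm : 1 ≤ m)
    (hhold : ∃ᶠ n in atTop, ω (n + 1) = ω n) (r : ℕ) :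
    ω ∈ eventuallyIn m C r ↔ ω ∈ eventuallyIn m C 0 := by
  have hclose := hω.eventually_forall_abs_sub_lt hm one_half_pos
  obtain ⟨n, hn, h1, h2⟩ :=
    (hhold.and_eventually (hclose.and ((tendsto_add_atTop_nat 1).eventually hclose))).exists
  induction r with
  | zero => rfl
  | succ r ih =>
    have h3 := h1 (r + 1 + (m - 1))
    have h4 := h2 (r + 1)
    rw [hn, show r + 1 + (n + 1) * (m - 1) = r + 1 + (m - 1) + n * (m - 1) by ring] at h4
    have h5 := indicator_one_eq_of_abs_sub_lt h4 h3
    rw [show r + 1 + (m - 1) = r + 1 * m by omega, eventuallyIn_add_mul] at h5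
    exact h5.trans ih

/-- If some typical path has infinitely many holding times, then all typical paths agree on
whether their `m`-step subsequence is eventually in `C`. -/
lemma mem_L_iff_of_hold (hω : X.TypicalPath m C ω) (hη : X.TypicalPath m C η) (hm : 1 ≤ m)
    (hhold : ∃ᶠ n in atTop, ω (n + 1) = ω n) : ω ∈ X.L m C ↔ η ∈ X.L m C := by
  obtain ⟨N, hN⟩ := eventually_atTop.1 (hω.eventually_forall_abs_sub_lt hm one_half_pos)
  obtain ⟨M, hM⟩ := eventually_atTop.1 (hη.eventually_forall_abs_sub_lt hm one_half_pos)
  obtain ⟨n, hn, hn'⟩ := hω.exists_ge_eq (le_max_left (ω N) (η M))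
  obtain ⟨k, hk, hk'⟩ := hη.exists_ge_eq (le_max_right (ω N) (η M))
  have h1 := hN n hn (k * (m - 1) + n)
  have h2 := hM k hk 0
  have hG : eventuallyIn m C (k * (m - 1) + n + n * (m - 1)) = eventuallyIn m C (k * (m - 1)) := by
    obtain ⟨j, rfl⟩ := Nat.exists_eq_add_of_le' hm
    rw [← eventuallyIn_add_mul _ C (k * (j + 1 - 1)) n, Nat.add_sub_cancel]
    congr 1
    ring
  rw [hn', hG] at h1
  rw [hk', zero_add] at h2
  rw [L_eq_eventuallyIn, ← hω.mem_eventuallyIn_iff_of_hold hm hhold (k * (m - 1) + n)]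
  exact indicator_one_eq_of_abs_sub_lt h1 h2

/-- Two typical paths that never hold from some time on and have the same parity agree on
whether their 2-step subsequence is eventually in `C`. -/
lemma mem_L_two_iff_of_parity (hω : X.TypicalPath 2 C ω) (hη : X.TypicalPath 2 C η) {c : ℕ}
    (hωc : ∀ᶠ n in atTop, (ω n + n) % 2 = c) (hηc : ∀ᶠ n in atTop, (η n + n) % 2 = c) :
    ω ∈ X.L 2 C ↔ η ∈ X.L 2 C := by
  obtain ⟨N, hN⟩ := eventually_atTop.1
    ((hω.eventually_forall_abs_sub_lt one_le_two one_half_pos).and hωc)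
  obtain ⟨M, hM⟩ := eventually_atTop.1
    ((hη.eventually_forall_abs_sub_lt one_le_two one_half_pos).and hηc)
  obtain ⟨n, hn, hn'⟩ := hω.exists_ge_eq (le_max_left (ω N) (η M))
  obtain ⟨k, hk, hk'⟩ := hη.exists_ge_eq (le_max_right (ω N) (η M))
  have h1 := (hN n hn).1 0
  have h2 := (hM k hk).1 0
  have hpar : n % 2 = k % 2 := by
    have := (hN n hn).2
    have := (hM k hk).2
    rw [hn'] at *
    rw [hk'] at *
    omega
  have hG : eventuallyIn 2 C n = eventuallyIn 2 C k := by
    rw [← eventuallyIn_mod, hpar, eventuallyIn_mod]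
  rw [hn', show 0 + n * (2 - 1) = n by omega, hG] at h1
  rw [hk', show 0 + k * (2 - 1) = k by omega] at h2
  exact indicator_one_eq_of_abs_sub_lt h1 h2

lemma exists_parity (hω : X.TypicalPath m C ω) (hhold : ∀ᶠ n in atTop, ω (n + 1) ≠ ω n) :
    ∃ c < 2, ∀ᶠ n in atTop, (ω n + n) % 2 = c := by
  obtain ⟨N, hN⟩ := eventually_atTop.1 hhold
  refine ⟨(ω N + N) % 2, Nat.mod_lt _ two_pos, eventually_atTop.2 ⟨N, fun n hn => ?_⟩⟩
  induction n, hn using Nat.le_induction with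
  | base => rfl
  | succ n hn ih =>
    have := hN n hn
    have := hω.step n
    omega

end TypicalPath

section General

variable {S : Type} [MeasurableSpace S] {Y : MarkovChain S} {m : ℕ} {A B C : Set S}

lemma L_subset_U : Y.L m C ⊆ Y.U m C := by
  rintro ω ⟨N, hN⟩ n
  exact ⟨max N n, le_max_right _ _, hN _ (le_max_left _ _)⟩

lemma U_mono (h : A ⊆ B) : Y.U m A ⊆ Y.U m B := fun _ hω n =>
  let ⟨k, hk, hk'⟩ := hω n
  ⟨k, hk, h hk'⟩

lemma L_inter : Y.L m (A ∩ B) = Y.L m A ∩ Y.L m B := by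
  ext ω
  simp only [L_eq_eventuallyIn, mem_inter_iff, mem_eventuallyIn, eventually_and]

lemma L_empty : Y.L m (∅ : Set S) = ∅ :=
  eq_empty_of_forall_notMem fun _ ⟨N, hN⟩ => hN N le_rfl

lemma disjoint_L (h : Disjoint A B) : Disjoint (Y.L m A) (Y.L m B) := by
  rw [disjoint_iff_inter_eq_empty, ← L_inter, h.inter_eq, L_empty]

lemma almostClosed_of_ae (h : ∀ᵐ ω ∂Y.μ, ω ∈ Y.U m C → ω ∈ Y.L m C)
    (h0 : Y.μ (Y.L m C) ≠ 0) : Y.AlmostClosed m C := by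
  refine ⟨measure_symmDiff_eq_zero_iff.2 ?_, fun hU => h0 (measure_mono_null L_subset_U hU)⟩
  filter_upwards [h] with ω hω
  exact propext ⟨hω, fun h => L_subset_U (Y := Y) h⟩

lemma AlmostClosed.measure_L_ne_zero (h : Y.AlmostClosed m C) : Y.μ (Y.L m C) ≠ 0 := by
  rw [← measure_congr (measure_symmDiff_eq_zero_iff.1 h.1)]
  exact h.2

lemma IsBlackwell.nonempty {𝒞 : Set (Set S)} (h : Y.IsBlackwell m 𝒞) : 𝒞.Nonempty := by
  rw [nonempty_iff_ne_empty]
  rintro rfl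
  simpa using h.sum_L_eq_one

lemma beta_eq_one_of_isBlackwell (h : Y.IsBlackwell m {C}) : Y.beta m = 1 := by
  refine le_antisymm (sInf_le ⟨{C}, h, encard_singleton C⟩) (le_sInf ?_)
  rintro _ ⟨𝒞, h𝒞, rfl⟩
  exact one_le_encard_iff_nonempty.2 h𝒞.nonempty

end General

namespace IsBirthDeath

lemma ae_mem_L_or_ae_notMem_L (hbd : X.IsBirthDeath) {m : ℕ} (hm : 1 ≤ m)
    (hhold : ∃ᵐ ω ∂X.μ, ∃ᶠ n in atTop, ω (n + 1) = ω n) (C : Set ℕ) :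
    (∀ᵐ ω ∂X.μ, ω ∈ X.L m C) ∨ ∀ᵐ ω ∂X.μ, ω ∉ X.L m C := by
  obtain ⟨ω, h1, hω⟩ := (hhold.and_eventually (hbd.ae_typicalPath hm C)).exists
  by_cases h : ω ∈ X.L m C
  · left
    filter_upwards [hbd.ae_typicalPath hm C] with η hη
    exact (hω.mem_L_iff_of_hold hη hm h1).1 h
  · right
    filter_upwards [hbd.ae_typicalPath hm C] with η hη
    exact fun hmem => h ((hω.mem_L_iff_of_hold hη hm h1).2 hmem)

/-- If the chain holds infinitely often with positive probability, all `m`-step chains are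
simple. -/
lemma beta_eq_one_of_hold (hbd : X.IsBirthDeath) {m : ℕ} (hm : 1 ≤ m)
    (hhold : ∃ᵐ ω ∂X.μ, ∃ᶠ n in atTop, ω (n + 1) = ω n) : X.beta m = 1 := by
  have hL : X.L m univ = univ := eq_univ_of_forall fun _ => ⟨0, fun _ _ => trivial⟩
  have hac : X.AlmostClosed m univ :=
    almostClosed_of_ae (ae_of_all _ fun ω _ => hL ▸ mem_univ ω) (by simp [hL])
  have hatom : X.Atomic m univ := by
    refine ⟨hac, ?_⟩
    rintro ⟨A, B, -, -, hAB, hA, hB⟩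
    have hae : ∀ C, X.AlmostClosed m C → ∀ᵐ ω ∂X.μ, ω ∈ X.L m C := fun C hC =>
      (hbd.ae_mem_L_or_ae_notMem_L hm hhold C).resolve_right fun h =>
        hC.measure_L_ne_zero (measure_eq_zero_iff_ae_notMem.2 h)
    obtain ⟨ω, h1, h2⟩ := ((hae A hA).and (hae B hB)).exists
    exact (disjoint_L hAB).notMem_of_mem_left h1 h2
  refine beta_eq_one_of_isBlackwell (C := univ) ?_
  constructor
  · exact countable_singleton _
  · rintro _ rfl
    exact hac
  · exact pairwiseDisjoint_singleton _ _
  · rintro _ rfl _ rfl _ _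
    rfl
  · rintro _ rfl h
    exact absurd hatom h
  · rintro _ rfl h
    exact absurd hatom h
  · rw [tsum_singleton univ fun C => X.μ (X.L m C), hL, measure_univ]

/-- The states of parity `c`. -/
def parityClass (c : ℕ) : Set ℕ := {x | x % 2 = c}

lemma ae_exists_parity (hbd : X.IsBirthDeath)
    (hhold : ∀ᵐ ω ∂X.μ, ∀ᶠ n in atTop, ω (n + 1) ≠ ω n) :
    ∀ᵐ ω ∂X.μ, ∃ c < 2, ∀ᶠ n in atTop, (ω n + n) % 2 = c := by
  filter_upwards [hbd.ae_typicalPath one_le_two univ, hhold] with ω h1 h2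
  exact h1.exists_parity h2

lemma mem_eventuallyIn_parityClass {ω : ℕ → ℕ} {c d r : ℕ} (hd : d < 2)
    (h : ∀ᶠ n in atTop, (ω n + n) % 2 = c) (hr : (d + r) % 2 = c) :
    ω ∈ eventuallyIn 2 (parityClass d) r := by
  rw [mem_eventuallyIn]
  obtain ⟨N, hN⟩ := eventually_atTop.1 h
  filter_upwards [eventually_ge_atTop N] with k hk
  have := hN (k * 2 + r) (by omega)
  simp only [parityClass, mem_ofPred_eq]
  omega

lemma eq_of_mem_U_parityClass {ω : ℕ → ℕ} {c d : ℕ} (hd : d < 2)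
    (h : ∀ᶠ n in atTop, (ω n + n) % 2 = c) (hU : ω ∈ X.U 2 (parityClass d)) : c = d := by
  obtain ⟨N, hN⟩ := eventually_atTop.1 h
  obtain ⟨k, hk, hk'⟩ := hU N
  have := hN (k * 2) (by omega)
  simp only [parityClass, mem_ofPred_eq] at hk'
  omega

lemma measure_L_parityClass_ne_zero (hbd : X.IsBirthDeath)
    (hhold : ∀ᵐ ω ∂X.μ, ∀ᶠ n in atTop, ω (n + 1) ≠ ω n) {d : ℕ} (hd : d < 2) :
    X.μ (X.L 2 (parityClass d)) ≠ 0 := by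
  set G := eventuallyIn 2 (parityClass d) with hG
  intro h0
  have hm : ∀ r, MeasurableSet (G r) := measurableSet_eventuallyIn 2 _
  have hshift : ∀ r, shiftBy 1 ⁻¹' G r = G (r + 1) := fun r =>
    shiftBy_preimage_eventuallyIn 2 _ r 1
  have hmod : ∀ r s, r % 2 = s % 2 → G r = G s := fun r s h => by
    rw [hG, ← eventuallyIn_mod, h, eventuallyIn_mod]
  have hsucc : ∀ x y r, 0 < X.P x y → X.startAt x (G r) = 0 → X.startAt y (G (r + 1)) = 0 :=
    fun x y r hxy h => (hbd.accessible x).startAt_eq_zero_of_step hxy (hm _) (by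
      rwa [hshift, hmod (r + 1 + 1) r (by omega)])
  have hinit : ∃ x, ∃ r, X.startAt x (G r) = 0 := by
    obtain ⟨x, n, ω, hω, -⟩ := X.exists_accessible
    refine ⟨ω n, n, ?_⟩
    rw [startAt_apply_eq_zero_iff X hω (hm _), hG, shiftBy_preimage_eventuallyIn, ← hG,
      hmod (n + n) 0 (by omega)]
    exact measure_mono_null inter_subset_right h0
  obtain ⟨i, hi⟩ := hbd.self_pos
  obtain ⟨r, hr⟩ := hbd.forall_of_step (Z := fun x => ∃ r, X.startAt x (G r) = 0) hinit
    (fun x y hxy ⟨r, hr⟩ => ⟨r + 1, hsucc x y r hxy hr⟩) i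
  have hnull : ∀ y r, X.startAt y (G r) = 0 := by
    refine hbd.startAt_eq_zero_of_shift hm hshift ⟨i, fun s => ?_⟩
    rcases (by omega : s % 2 = r % 2 ∨ s % 2 = (r + 1) % 2) with h | h
    · rwa [hmod s r h]
    · rw [hmod s (r + 1) h]
      exact hsucc i i r hi hr
  obtain ⟨ω, h1, c, hc, h2⟩ :=
    ((hbd.ae_typicalPath one_le_two (parityClass d)).and (hbd.ae_exists_parity hhold)).exists
  have h3 := h1.tendsto (c + d)
  rw [indicator_of_mem (mem_eventuallyIn_parityClass hd h2 (by omega))] at h3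
  simp only [← hG, hnull, ENNReal.toReal_zero, Pi.one_apply] at h3
  exact zero_ne_one (tendsto_nhds_unique tendsto_const_nhds h3)

lemma ae_mem_L_parityClass (hbd : X.IsBirthDeath)
    (hhold : ∀ᵐ ω ∂X.μ, ∀ᶠ n in atTop, ω (n + 1) ≠ ω n) {d : ℕ} (hd : d < 2) :
    ∀ᵐ ω ∂X.μ, ω ∈ X.U 2 (parityClass d) → ω ∈ X.L 2 (parityClass d) := by
  filter_upwards [hbd.ae_exists_parity hhold] with ω ⟨c, hc, h⟩ hU
  obtain rfl := eq_of_mem_U_parityClass hd h hU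
  exact mem_eventuallyIn_parityClass (r := 0) hd h (by omega)

lemma almostClosed_parityClass (hbd : X.IsBirthDeath)
    (hhold : ∀ᵐ ω ∂X.μ, ∀ᶠ n in atTop, ω (n + 1) ≠ ω n) {d : ℕ} (hd : d < 2) :
    X.AlmostClosed 2 (parityClass d) :=
  almostClosed_of_ae (hbd.ae_mem_L_parityClass hhold hd)
    (hbd.measure_L_parityClass_ne_zero hhold hd)

lemma atomic_of_subset_parityClass (hbd : X.IsBirthDeath)
    (hhold : ∀ᵐ ω ∂X.μ, ∀ᶠ n in atTop, ω (n + 1) ≠ ω n) {d : ℕ} (hd : d < 2) {C : Set ℕ}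
    (hC : C ⊆ parityClass d) (hac : X.AlmostClosed 2 C) : X.Atomic 2 C := by
  refine ⟨hac, ?_⟩
  rintro ⟨A, B, hAC, hBC, hAB, hA, hB⟩
  have hpath : ∀ D ⊆ C, X.AlmostClosed 2 D → ∃ ω ∈ X.L 2 D, X.TypicalPath 2 A ω ∧
      ∀ᶠ n in atTop, (ω n + n) % 2 = d := by
    intro D hD hDac
    obtain ⟨ω, h1, h2, c, -, h3⟩ :=
      ((frequently_ae_iff.2 hDac.measure_L_ne_zero).and_eventually
        ((hbd.ae_typicalPath one_le_two A).and (hbd.ae_exists_parity hhold))).exists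
    have hcd := eq_of_mem_U_parityClass (X := X) hd h3
      (U_mono (Y := X) (hD.trans hC) (L_subset_U (Y := X) h1))
    exact ⟨ω, h1, h2, hcd ▸ h3⟩
  obtain ⟨ω, h1, h2, h3⟩ := hpath A hAC hA
  obtain ⟨η, h4, h5, h6⟩ := hpath B hBC hB
  exact (disjoint_L hAB).notMem_of_mem_left ((h2.mem_L_two_iff_of_parity h5 h3 h6).1 h1) h4

lemma isBlackwell_parityClass (hbd : X.IsBirthDeath)
    (hhold : ∀ᵐ ω ∂X.μ, ∀ᶠ n in atTop, ω (n + 1) ≠ ω n) :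
    X.IsBlackwell 2 {parityClass 0, parityClass 1} := by
  have hmem : ∀ C ∈ ({parityClass 0, parityClass 1} : Set (Set ℕ)),
      ∃ d < 2, C = parityClass d := by
    rintro _ (rfl | rfl)
    exacts [⟨0, two_pos, rfl⟩, ⟨1, one_lt_two, rfl⟩]
  have hatom : ∀ C ∈ ({parityClass 0, parityClass 1} : Set (Set ℕ)), X.Atomic 2 C := by
    intro C hC
    obtain ⟨d, hd, rfl⟩ := hmem C hC
    exact hbd.atomic_of_subset_parityClass hhold hd le_rfl
      (hbd.almostClosed_parityClass hhold hd)
  have hdisj : Disjoint (parityClass 0) (parityClass 1) := by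
    rw [Set.disjoint_left]
    intro x h0 h1
    simp only [parityClass, mem_ofPred_eq] at h0 h1
    omega
  refine ⟨(Set.toFinite _).countable, fun C hC => (hatom C hC).1, ?_,
    fun C hC _ _ h => absurd (hatom C hC) h, fun C hC h => absurd (hatom C hC) h,
    fun C hC h => absurd (hatom C hC) h, ?_⟩
  · exact pairwiseDisjoint_insert.2 ⟨pairwiseDisjoint_singleton _ _, by rintro _ rfl _; exact hdisj⟩
  · have hpair : ({parityClass 0, parityClass 1} : Set (Set ℕ)).PairwiseDisjoint (X.L 2) :=
      pairwiseDisjoint_insert.2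
        ⟨pairwiseDisjoint_singleton _ _, by rintro _ rfl _; exact disjoint_L hdisj⟩
    have hmeas : ∀ C, MeasurableSet (X.L 2 C) := fun C => measurableSet_eventuallyIn 2 C 0
    refine (measure_biUnion (Set.toFinite _).countable hpair fun C _ => hmeas C).symm.trans ?_
    rw [biUnion_pair]
    refine (mem_ae_iff_prob_eq_one ((hmeas _).union (hmeas _))).1 ?_
    filter_upwards [hbd.ae_exists_parity hhold] with ω ⟨c, hc, h⟩
    rcases (by omega : c = 0 ∨ c = 1) with rfl | rfl
    · exact Or.inl (mem_eventuallyIn_parityClass (r := 0) hc h rfl)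
    · exact Or.inr (mem_eventuallyIn_parityClass (r := 0) hc h rfl)

lemma two_le_encard_of_isBlackwell (hbd : X.IsBirthDeath)
    (hhold : ∀ᵐ ω ∂X.μ, ∀ᶠ n in atTop, ω (n + 1) ≠ ω n) {𝒞 : Set (Set ℕ)}
    (h𝒞 : X.IsBlackwell 2 𝒞) : 2 ≤ 𝒞.encard := by
  by_contra! hlt
  obtain ⟨C, rfl⟩ : ∃ C, 𝒞 = {C} := encard_eq_one.1 <|
    le_antisymm (Order.le_of_lt_add_one (by simpa [one_add_one_eq_two] using hlt))
      (one_le_encard_iff_nonempty.2 h𝒞.nonempty)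
  have hL : X.μ (X.L 2 C) = 1 := by
    rw [← h𝒞.sum_L_eq_one, tsum_singleton C fun C => X.μ (X.L 2 C)]
  have hLae : ∀ᵐ ω ∂X.μ, ω ∈ X.L 2 C :=
    (mem_ae_iff_prob_eq_one (measurableSet_eventuallyIn 2 C 0)).2 hL
  have hac : ∀ d < 2, X.AlmostClosed 2 (C ∩ parityClass d) := by
    intro d hd
    refine almostClosed_of_ae ?_ ?_
    · filter_upwards [hLae, hbd.ae_mem_L_parityClass hhold hd] with ω h1 h2 h3
      rw [L_inter]
      exact ⟨h1, h2 (U_mono inter_subset_right h3)⟩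
    · rw [L_inter, Measure.measure_inter_eq_of_ae hLae]
      exact hbd.measure_L_parityClass_ne_zero hhold hd
  by_cases hat : X.Atomic 2 C
  · refine hat.2 ⟨_, _, inter_subset_left, inter_subset_left, ?_, hac 0 two_pos, hac 1 one_lt_two⟩
    rw [Set.disjoint_left]
    rintro x ⟨-, h0⟩ ⟨-, h1⟩
    simp only [parityClass, mem_ofPred_eq] at h0 h1
    omega
  · exact h𝒞.nonatomicNoAtomicSubset C rfl hat _ inter_subset_left
      (hbd.atomic_of_subset_parityClass hhold two_pos inter_subset_right (hac 0 two_pos))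

/-- If the chain almost surely holds only finitely often, the 2-step chain splits into the two
parity classes. -/
lemma beta_two_eq_two_of_no_hold (hbd : X.IsBirthDeath)
    (hhold : ∀ᵐ ω ∂X.μ, ∀ᶠ n in atTop, ω (n + 1) ≠ ω n) : X.beta 2 = 2 := by
  refine le_antisymm (sInf_le_of_le ⟨_, hbd.isBlackwell_parityClass hhold, rfl⟩
    ((encard_insert_le _ _).trans (by simp [one_add_one_eq_two]))) (le_sInf ?_)
  rintro _ ⟨𝒞, h𝒞, rfl⟩
  exact hbd.two_le_encard_of_isBlackwell hhold h𝒞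

end IsBirthDeath

end MarkovChain

/-- A birth-death process `X` is asymptotically aperiodic if and
only if the 2-step chain `X^(2)` is simple. -/
theorem stmt16 (X : MarkovChain ℕ) (hbd : X.IsBirthDeath)
    (hirr : X.Irreducible) (hap : X.Aperiodic) :
    X.period = 1 ↔ X.beta 2 = 1 := by
  by_cases hhold : ∃ᵐ ω ∂X.μ, ∃ᶠ n in atTop, ω (n + 1) = ω n
  · refine iff_of_true (le_antisymm (sSup_le ?_) (le_sSup ?_))
      (hbd.beta_eq_one_of_hold one_le_two hhold)
    · rintro _ ⟨m, hm, hbeta, rfl⟩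
      rw [← hbeta, hbd.beta_eq_one_of_hold hm hhold]
    · exact ⟨1, le_rfl, by simpa using hbd.beta_eq_one_of_hold le_rfl hhold, by simp⟩
  · have h2 : X.beta 2 = 2 := hbd.beta_two_eq_two_of_no_hold (by simpa using hhold)
    have hperiod : 2 ≤ X.period := le_sSup ⟨2, one_le_two, by simpa using h2, by simp⟩
    refine iff_of_false (fun h => ?_) (by simp [h2])
    rw [h] at hperiod
    exact absurd hperiod (by norm_num)
end

section
/- For a birth-death process X, the 2-step chain X^(2) is simple if and only if |Q_n(−1)| → ∞ as n → ∞. -/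
open MeasureTheory Filter Set ProbabilityTheory

namespace BirthDeath

/-- Prepend a state to a path. -/
def pathCons (i : ℕ) (ω : ℕ → ℕ) : ℕ → ℕ
  | 0 => i
  | n + 1 => ω n

@[simp] lemma pathCons_zero (i : ℕ) (ω : ℕ → ℕ) : pathCons i ω 0 = i := rfl

@[simp] lemma pathCons_succ (i : ℕ) (ω : ℕ → ℕ) (n : ℕ) : pathCons i ω (n + 1) = ω n := rfl

@[simp] lemma pathShift_apply {S : Type} (ω : ℕ → S) (n : ℕ) : pathShift ω n = ω (n + 1) := rfl

lemma measurable_pathCons (i : ℕ) : Measurable (pathCons i) := by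
  refine measurable_pi_lambda _ fun n => ?_
  cases n with
  | zero => exact measurable_const
  | succ n => exact measurable_pi_apply n

lemma measurable_pathShift : Measurable (pathShift : (ℕ → ℕ) → ℕ → ℕ) :=
  measurable_pi_lambda _ fun n => measurable_pi_apply (n + 1)

/-- The cylinder sets of the path space. -/
def cylinders : Set (Set (ℕ → ℕ)) := {C | ∃ s n, C = PiNat.cylinder s n}

lemma isPiSystem_cylinders : IsPiSystem cylinders := by
  rintro _ ⟨s, n, rfl⟩ _ ⟨t, m, rfl⟩ ⟨x, hxs, hxt⟩
  rw [PiNat.mem_cylinder_iff_eq] at hxs hxt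
  rw [← hxs, ← hxt]
  rcases le_total n m with h | h
  · exact ⟨x, m, inter_eq_right.2 (PiNat.cylinder_anti x h)⟩
  · exact ⟨x, n, inter_eq_left.2 (PiNat.cylinder_anti x h)⟩

lemma generateFrom_cylinders :
    (MeasurableSpace.pi : MeasurableSpace (ℕ → ℕ)) = MeasurableSpace.generateFrom cylinders := by
  rw [BorelSpace.measurable_eq (α := ℕ → ℕ)]
  exact (PiNat.isTopologicalBasis_cylinders fun _ : ℕ => ℕ).borel_eq_generateFrom

lemma measurableSet_cylinder (s : ℕ → ℕ) (n : ℕ) : MeasurableSet (PiNat.cylinder s n) := by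
  rw [generateFrom_cylinders]
  exact .basic _ ⟨s, n, rfl⟩

lemma preimage_pathCons_cylinder (i : ℕ) (s : ℕ → ℕ) (n : ℕ) :
    pathCons i ⁻¹' PiNat.cylinder s (n + 1)
      = if s 0 = i then PiNat.cylinder (pathShift s) n else ∅ := by
  ext ω
  simp only [mem_preimage, PiNat.mem_cylinder_iff, Nat.forall_lt_succ_left', pathCons_zero,
    pathCons_succ]
  split_ifs with h
  · simp [h, PiNat.mem_cylinder_iff]
  · simp [Ne.symm h]

/-- `ν` is the law of the paths started at `i` with transition probabilities `P`. -/
structure IsPathLaw (P : ℕ → ℕ → ℝ) (i : ℕ) (ν : Measure (ℕ → ℕ)) : Prop where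
  isProb : IsProbabilityMeasure ν
  cylinder : ∀ (n : ℕ) (s : ℕ → ℕ), ν (PiNat.cylinder s (n + 1))
    = if s 0 = i then ENNReal.ofReal (∏ k ∈ Finset.range n, P (s k) (s (k + 1))) else 0

lemma cylinder_succ_eq (s : ℕ → ℕ) (n : ℕ) :
    PiNat.cylinder s (n + 1) = {ω | ∀ k ≤ n, ω k = s k} := by
  ext ω
  simp [PiNat.mem_cylinder_iff]

variable {X : MarkovChain ℕ}

lemma measure_cylinder (n : ℕ) (s : ℕ → ℕ) : X.μ (PiNat.cylinder s (n + 1))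
    = ENNReal.ofReal (X.init (s 0) * ∏ k ∈ Finset.range n, X.P (s k) (s (k + 1))) := by
  rw [cylinder_succ_eq, X.μ_cylinder]

lemma cylinder_one (s : ℕ → ℕ) : PiNat.cylinder s 1 = {ω | ω 0 = s 0} := by
  ext ω
  simp [PiNat.mem_cylinder_iff]

lemma exists_isPathLaw_of_init_pos {i : ℕ} (hi : 0 < X.init i) : ∃ ν, IsPathLaw X.P i ν := by
  have := X.μ_prob
  have h0 : X.μ {ω | ω 0 = i} = ENNReal.ofReal (X.init i) := by
    simpa [cylinder_one] using measure_cylinder (X := X) 0 fun _ => i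
  have hpos : ENNReal.ofReal (X.init i) ≠ 0 := by simpa using hi
  have hms : MeasurableSet {ω : ℕ → ℕ | ω 0 = i} := by
    simpa [cylinder_one] using measurableSet_cylinder (fun _ => i) 1
  refine ⟨X.μ[|{ω | ω 0 = i}], cond_isProbabilityMeasure (by rwa [h0]), fun n s => ?_⟩
  rw [cond_apply hms, h0]
  split_ifs with h
  · have : {ω : ℕ → ℕ | ω 0 = i} ∩ PiNat.cylinder s (n + 1) = PiNat.cylinder s (n + 1) := by
      refine inter_eq_right.2 fun ω hω => ?_
      rw [PiNat.mem_cylinder_iff] at hω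
      simpa [h] using hω 0 n.succ_pos
    rw [this, measure_cylinder, h, ENNReal.ofReal_mul hi.le, ← mul_assoc,
      ENNReal.inv_mul_cancel hpos ENNReal.ofReal_ne_top, one_mul]
  · have : {ω : ℕ → ℕ | ω 0 = i} ∩ PiNat.cylinder s (n + 1) = ∅ := by
      refine eq_empty_of_forall_notMem fun ω hω => h ?_
      have := (PiNat.mem_cylinder_iff.1 hω.2) 0 n.succ_pos
      rw [← this]
      exact hω.1
    simp [this]

lemma IsPathLaw.exists_of_step {i j : ℕ} {ν : Measure (ℕ → ℕ)} (hν : IsPathLaw X.P i ν)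
    (hij : 0 < X.P i j) : ∃ ν', IsPathLaw X.P j ν' := by
  have := hν.isProb
  let B : Set (ℕ → ℕ) := PiNat.cylinder (pathCons i fun _ => j) 2
  have hB : MeasurableSet B := measurableSet_cylinder _ _
  have hνB : ν B = ENNReal.ofReal (X.P i j) := by
    rw [hν.cylinder 1]
    simp
  have hpos : ENNReal.ofReal (X.P i j) ≠ 0 := by simpa using hij
  have := cond_isProbabilityMeasure (μ := ν) (s := B) (by rwa [hνB])
  refine ⟨(ν[|B]).map pathShift,
    Measure.isProbabilityMeasure_map measurable_pathShift.aemeasurable, fun n s => ?_⟩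
  rw [Measure.map_apply measurable_pathShift (measurableSet_cylinder _ _), cond_apply hB, hνB]
  split_ifs with h
  · have : B ∩ pathShift ⁻¹' PiNat.cylinder s (n + 1)
        = PiNat.cylinder (pathCons i s) (n + 1 + 1) := by
      ext ω
      simp only [B, mem_inter_iff, mem_preimage, PiNat.mem_cylinder_iff, pathShift_apply]
      constructor
      · rintro ⟨h1, h2⟩ k hk
        cases k with
        | zero => exact h1 0 (by norm_num)
        | succ k => exact h2 k (by omega)
      · intro h1
        refine ⟨fun k hk => ?_, fun k hk => h1 (k + 1) (by omega)⟩
        have := h1 k (by omega)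
        interval_cases k
        · exact this
        · simpa [h] using this
    rw [this, hν.cylinder, if_pos (pathCons_zero i s), Finset.prod_range_succ']
    simp only [pathCons_succ, pathCons_zero, zero_add, h]
    rw [mul_comm (∏ _ ∈ _, _), ENNReal.ofReal_mul hij.le, ← mul_assoc,
      ENNReal.inv_mul_cancel hpos ENNReal.ofReal_ne_top, one_mul]
  · have : B ∩ pathShift ⁻¹' PiNat.cylinder s (n + 1) = ∅ := by
      refine eq_empty_of_forall_notMem fun ω hω => h ?_
      have h1 := PiNat.mem_cylinder_iff.1 hω.1 1 (by norm_num)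
      have h2 := PiNat.mem_cylinder_iff.1 hω.2 0 n.succ_pos
      simp only [pathShift_apply, zero_add] at h2
      rw [← h2, h1]
      rfl
    simp [this]

lemma exists_init_pos (X : MarkovChain ℕ) : ∃ i, 0 < X.init i := by
  by_contra! h
  have : X.init = 0 := funext fun i => le_antisymm (h i) (X.init_nonneg i)
  have h1 := X.init_hasSum
  rw [this] at h1
  exact zero_ne_one (hasSum_zero.unique h1)

lemma exists_isPathLaw (hbd : X.IsBirthDeath) (i : ℕ) : ∃ ν, IsPathLaw X.P i ν := by
  obtain ⟨i₀, hi₀⟩ := exists_init_pos X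
  have up : ∀ k i, (∃ ν, IsPathLaw X.P i ν) → ∃ ν, IsPathLaw X.P (i + k) ν := by
    intro k i h
    induction k with
    | zero => exact h
    | succ k ih => exact ih.elim fun ν hν => hν.exists_of_step (hbd.birth_pos _)
  have down : ∀ i, (∃ ν, IsPathLaw X.P i ν) → ∃ ν, IsPathLaw X.P 0 ν := by
    intro i h
    induction i with
    | zero => exact h
    | succ i ih => exact ih (h.elim fun ν hν => hν.exists_of_step (hbd.death_pos _))
  simpa using up i 0 (down i₀ (exists_isPathLaw_of_init_pos hi₀))

lemma transition_eq_zero (hbd : X.IsBirthDeath) {i j : ℕ} (h : i + 2 ≤ j ∨ j + 2 ≤ i) :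
    X.P i j = 0 :=
  hbd.tridiagonal i j (by rw [lt_abs]; omega)

lemma sum_transition (hbd : X.IsBirthDeath) (i : ℕ) : ∑ j ∈ Finset.range (i + 2), X.P i j = 1 :=
  (hasSum_sum_of_ne_finset_zero fun j hj => transition_eq_zero hbd
    (Or.inl (by simpa using hj))).unique (X.P_stochastic i)

/-- The one-step Markov property. -/
lemma measure_eq_sum (hbd : X.IsBirthDeath) {ν : ℕ → Measure (ℕ → ℕ)}
    (hν : ∀ i, IsPathLaw X.P i (ν i)) (i : ℕ) :
    ν i = ∑ j ∈ Finset.range (i + 2), ENNReal.ofReal (X.P i j) • (ν j).map (pathCons i) := by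
  have hprob := fun i => (hν i).isProb
  have huniv : ν i univ = (∑ j ∈ Finset.range (i + 2),
      ENNReal.ofReal (X.P i j) • (ν j).map (pathCons i)) univ := by
    simp only [Measure.coe_finsetSum, Finset.sum_apply, Measure.smul_apply, smul_eq_mul,
      Measure.map_apply (measurable_pathCons i) MeasurableSet.univ, preimage_univ, measure_univ,
      mul_one]
    rw [← ENNReal.ofReal_sum_of_nonneg fun j _ => X.P_nonneg i j, sum_transition hbd,
      ENNReal.ofReal_one]
  refine ext_of_generate_finite _ generateFrom_cylinders isPiSystem_cylinders ?_ huniv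
  rintro _ ⟨s, n, rfl⟩
  cases n with
  | zero => simpa only [PiNat.cylinder_zero] using huniv
  | succ n =>
    simp only [Measure.coe_finsetSum, Finset.sum_apply, Measure.smul_apply, smul_eq_mul,
      Measure.map_apply (measurable_pathCons i) (measurableSet_cylinder _ _),
      preimage_pathCons_cylinder, (hν i).cylinder]
    split_ifs with h
    · cases n with
      | zero =>
        simp only [PiNat.cylinder_zero, measure_univ, mul_one, Finset.range_zero,
          Finset.prod_empty]
        rw [← ENNReal.ofReal_sum_of_nonneg fun j _ => X.P_nonneg i j, sum_transition hbd]
      | succ n =>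
        simp only [(hν _).cylinder, pathShift_apply, zero_add, mul_ite, mul_zero]
        rw [Finset.sum_ite_eq, Finset.prod_range_succ']
        split_ifs with h1
        · rw [mul_comm, ENNReal.ofReal_mul (X.P_nonneg _ _), h]
        · rw [zero_add, h, transition_eq_zero hbd (Or.inl (by simpa using h1))]
          simp
    · simp

/-- The action of the transition matrix on functions. -/
noncomputable def step (X : MarkovChain ℕ) (u : ℕ → ℝ) (i : ℕ) : ℝ :=
  ∑ j ∈ Finset.range (i + 2), X.P i j * u j

lemma real_eq_step (hbd : X.IsBirthDeath) {ν : ℕ → Measure (ℕ → ℕ)}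
    (hν : ∀ i, IsPathLaw X.P i (ν i)) {G : Set (ℕ → ℕ)} (hG : MeasurableSet G) (i : ℕ) :
    (ν i).real G = step X (fun j => (ν j).real (pathCons i ⁻¹' G)) i := by
  have hprob := fun i => (hν i).isProb
  rw [Measure.real, measure_eq_sum hbd hν i]
  simp only [Measure.coe_finsetSum, Finset.sum_apply, Measure.smul_apply, smul_eq_mul,
    Measure.map_apply (measurable_pathCons i) hG]
  rw [ENNReal.toReal_sum fun j _ => ENNReal.mul_ne_top ENNReal.ofReal_ne_top (measure_ne_top _ _)]
  exact Finset.sum_congr rfl fun j _ => by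
    rw [ENNReal.toReal_mul, ENNReal.toReal_ofReal (X.P_nonneg i j)]; rfl

lemma real_preimage_pathShift (hbd : X.IsBirthDeath) {ν : ℕ → Measure (ℕ → ℕ)}
    (hν : ∀ i, IsPathLaw X.P i (ν i)) {G : Set (ℕ → ℕ)} (hG : MeasurableSet G) (i : ℕ) :
    (ν i).real (pathShift ⁻¹' G) = step X (fun j => (ν j).real G) i :=
  real_eq_step hbd hν (measurable_pathShift hG) i

/-- The law of the chain is the mixture of the laws with deterministic starting point. -/
lemma measure_eq_zero_iff {ν : ℕ → Measure (ℕ → ℕ)} (hν : ∀ i, IsPathLaw X.P i (ν i))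
    (G : Set (ℕ → ℕ)) : X.μ G = 0 ↔ ∀ i, 0 < X.init i → ν i G = 0 := by
  have := X.μ_prob
  have hprob := fun i => (hν i).isProb
  have key : X.μ = Measure.sum fun i => ENNReal.ofReal (X.init i) • ν i := by
    have huniv : X.μ univ = (Measure.sum fun i => ENNReal.ofReal (X.init i) • ν i) univ := by
      rw [Measure.sum_apply _ MeasurableSet.univ]
      simp only [Measure.smul_apply, smul_eq_mul, measure_univ, mul_one]
      rw [← ENNReal.ofReal_tsum_of_nonneg X.init_nonneg X.init_hasSum.summable,
        X.init_hasSum.tsum_eq, ENNReal.ofReal_one]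
    refine ext_of_generate_finite _ generateFrom_cylinders isPiSystem_cylinders ?_ huniv
    rintro _ ⟨s, n, rfl⟩
    cases n with
    | zero => simpa only [PiNat.cylinder_zero] using huniv
    | succ n =>
      rw [Measure.sum_apply _ (measurableSet_cylinder _ _)]
      simp only [Measure.smul_apply, smul_eq_mul, (hν _).cylinder, mul_ite, mul_zero]
      rw [measure_cylinder, ENNReal.ofReal_mul (X.init_nonneg _)]
      rw [tsum_eq_single (s 0) fun j hj => if_neg (Ne.symm hj), if_pos rfl]
  rw [key, Measure.sum_apply_eq_zero]
  refine forall_congr' fun i => ?_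
  simp [imp_iff_not_or]

lemma step_zero (u : ℕ → ℝ) : step X u 0 = X.P 0 0 * u 0 + X.P 0 1 * u 1 := by
  simp [step, Finset.sum_range_succ]

lemma step_succ (hbd : X.IsBirthDeath) (u : ℕ → ℝ) (n : ℕ) : step X u (n + 1)
    = X.P (n + 1) n * u n + X.P (n + 1) (n + 1) * u (n + 1) + X.P (n + 1) (n + 2) * u (n + 2) := by
  have : ∑ j ∈ Finset.range n, X.P (n + 1) j * u j = 0 := Finset.sum_eq_zero fun j hj => by
    rw [transition_eq_zero hbd (Or.inr (by simp at hj; omega)), zero_mul]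
  simp [step, Finset.sum_range_succ, this]

lemma step_add (u v : ℕ → ℝ) (i : ℕ) :
    step X (fun j => u j + v j) i = step X u i + step X v i := by
  simp [step, mul_add, Finset.sum_add_distrib]

lemma step_sub (u v : ℕ → ℝ) (i : ℕ) :
    step X (fun j => u j - v j) i = step X u i - step X v i := by
  simp [step, mul_sub, Finset.sum_sub_distrib]

lemma step_const_mul (c : ℝ) (u : ℕ → ℝ) (i : ℕ) :
    step X (fun j => c * u j) i = c * step X u i := by
  simp [step, Finset.mul_sum, mul_left_comm]

lemma step_const (hbd : X.IsBirthDeath) (c : ℝ) (i : ℕ) : step X (fun _ => c) i = c := by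
  simp [step, ← Finset.sum_mul, sum_transition hbd]

lemma step_sum {ι : Type*} (s : Finset ι) (x : ι → ℝ) (u : ι → ℕ → ℝ) (i : ℕ) :
    step X (fun j => ∑ k ∈ s, x k * u k j) i = ∑ k ∈ s, x k * step X (u k) i := by
  simp only [step, Finset.mul_sum]
  rw [Finset.sum_comm]
  simp only [mul_left_comm]

lemma step_mono {u v : ℕ → ℝ} (h : ∀ j, u j ≤ v j) (i : ℕ) : step X u i ≤ step X v i :=
  Finset.sum_le_sum fun j _ => mul_le_mul_of_nonneg_left (h j) (X.P_nonneg i j)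

/-- Eigenfunctions are determined by their value at `0`. -/
lemma eigenfunction_unique (hbd : X.IsBirthDeath) {c : ℝ} {u v : ℕ → ℝ}
    (hu : ∀ i, step X u i = c * u i) (hv : ∀ i, step X v i = c * v i) (h0 : u 0 = v 0) :
    u = v := by
  have key : ∀ n, u n = v n ∧ u (n + 1) = v (n + 1) := by
    intro n
    induction n with
    | zero =>
      refine ⟨h0, mul_left_cancel₀ (hbd.birth_pos 0).ne' ?_⟩
      have h1 := hu 0
      have h2 := hv 0
      rw [step_zero] at h1 h2
      rw [h0] at h1
      simp only [zero_add]
      linarith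
    | succ n ih =>
      refine ⟨ih.2, mul_left_cancel₀ (hbd.birth_pos (n + 1)).ne' ?_⟩
      have h1 := hu (n + 1)
      have h2 := hv (n + 1)
      rw [step_succ hbd] at h1 h2
      rw [ih.1, ih.2] at h1
      simp only [add_assoc, Nat.reduceAdd] at *
      linarith
  exact funext fun n => (key n).1

/-- A linear relation between the probabilities of finitely many events that are invariant under
the two-step shift localizes to all events. -/
lemma sum_inter_eq_zero (hbd : X.IsBirthDeath) {ν : ℕ → Measure (ℕ → ℕ)}
    (hν : ∀ i, IsPathLaw X.P i (ν i)) {ι : Type*} (t : Finset ι) (x : ι → ℝ)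
    (D : ι → Set (ℕ → ℕ)) (hD : ∀ k, MeasurableSet (D k)) (hinv : ∀ k, MInvariant 2 (D k))
    (hrel : ∀ i, ∑ k ∈ t, x k * (ν i).real (D k) = 0) (i : ℕ) {F : Set (ℕ → ℕ)}
    (hF : MeasurableSet F) : ∑ k ∈ t, x k * (ν i).real (D k ∩ F) = 0 := by
  have hprob := fun i => (hν i).isProb
  have hcyl : ∀ (n : ℕ) (D : ι → Set (ℕ → ℕ)), (∀ k, MeasurableSet (D k)) →
      (∀ k, MInvariant 2 (D k)) → (∀ i, ∑ k ∈ t, x k * (ν i).real (D k) = 0) →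
      ∀ i s, ∑ k ∈ t, x k * (ν i).real (D k ∩ PiNat.cylinder s n) = 0 := by
    intro n
    induction n with
    | zero => intro D _ _ hrel i s; simpa using hrel i
    | succ n ih =>
      intro D hD hinv hrel i s
      let D' : ι → Set (ℕ → ℕ) := fun k => pathShift ⁻¹' D k
      have hD' : ∀ k, MeasurableSet (D' k) := fun k => measurable_pathShift (hD k)
      have hinv' : ∀ k, MInvariant 2 (D' k) := fun k ω => hinv k (pathShift ω)
      have hrel' : ∀ i, ∑ k ∈ t, x k * (ν i).real (D' k) = 0 := fun i => by
        simp only [D', real_preimage_pathShift hbd hν (hD _), ← step_sum, hrel, step_const hbd]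
      have hcons : ∀ k, pathCons i ⁻¹' (D k ∩ PiNat.cylinder s (n + 1))
          = if s 0 = i then D' k ∩ PiNat.cylinder (pathShift s) n else ∅ := by
        intro k
        have : pathCons i ⁻¹' D k = D' k := by
          ext ω
          exact hinv k (pathCons i ω)
        rw [preimage_inter, this, preimage_pathCons_cylinder]
        split_ifs <;> simp
      simp only [real_eq_step hbd hν ((hD _).inter (measurableSet_cylinder s (n + 1))), hcons]
      rw [← step_sum]
      split_ifs with h
      · simp only [ih D' hD' hinv' hrel', step_const hbd]
      · simp [step]
  induction F, hF using MeasurableSpace.induction_on_inter generateFrom_cylinders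
    isPiSystem_cylinders with
  | empty => simp
  | basic C hC =>
    obtain ⟨s, n, rfl⟩ := hC
    exact hcyl n D hD hinv hrel i s
  | compl F hF ih =>
    have : ∀ k, (ν i).real (D k ∩ Fᶜ) = (ν i).real (D k) - (ν i).real (D k ∩ F) := fun k => by
      rw [← measureReal_inter_add_sdiff (s := D k) hF, sdiff_eq]
      ring
    simp only [this, mul_sub, Finset.sum_sub_distrib, hrel, ih, sub_zero]
  | iUnion f hd hf ih =>
    have hs : ∀ k, HasSum (fun m => x k * (ν i).real (D k ∩ f m))
        (x k * (ν i).real (D k ∩ ⋃ m, f m)) := fun k => by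
      rw [inter_iUnion]
      refine HasSum.mul_left _ ?_
      have hU := measure_iUnion (μ := ν i)
        (fun a b hab => (hd hab).mono inter_subset_right inter_subset_right)
        fun m => (hD k).inter (hf m)
      rw [Measure.real, hU, ENNReal.tsum_toReal_eq fun m => measure_ne_top _ _]
      exact ENNReal.hasSum_toReal (hU ▸ measure_ne_top _ _)
    have := hasSum_sum fun k (_ : k ∈ t) => hs k
    simp only [ih] at this
    exact this.unique hasSum_zero

/-- Disjoint invariant events of positive probability have linearly independent probabilities. -/
lemma linearIndependent_real (hbd : X.IsBirthDeath) {ν : ℕ → Measure (ℕ → ℕ)}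
    (hν : ∀ i, IsPathLaw X.P i (ν i)) {ι : Type*}
    {D : ι → Set (ℕ → ℕ)} (hD : ∀ k, MeasurableSet (D k)) (hinv : ∀ k, MInvariant 2 (D k))
    (hdisj : Pairwise fun k l => Disjoint (D k) (D l)) (hpos : ∀ k, X.μ (D k) ≠ 0) :
    LinearIndependent ℝ fun k i => (ν i).real (D k) := by
  have hprob := fun i => (hν i).isProb
  rw [linearIndependent_iff']
  intro t x hx l hl
  have hrel : ∀ i, ∑ k ∈ t, x k * (ν i).real (D k) = 0 := fun i => by
    simpa using congrFun hx i
  obtain ⟨i, hi⟩ : ∃ i, ν i (D l) ≠ 0 := by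
    by_contra! h
    exact hpos l ((measure_eq_zero_iff hν _).2 fun i _ => h i)
  have h := sum_inter_eq_zero hbd hν t x D hD hinv hrel i (hD l)
  rw [Finset.sum_eq_single_of_mem l hl fun k _ hk => by simp [(hdisj hk).inter_eq], inter_self]
    at h
  exact (mul_eq_zero.1 h).resolve_right fun h0 => hi ((measureReal_eq_zero_iff).1 h0)

/-- The probability of an invariant event is a combination of `1` and the alternating
eigenfunction `h`. -/
lemma real_invariant_eq (hbd : X.IsBirthDeath) {ν : ℕ → Measure (ℕ → ℕ)}
    (hν : ∀ i, IsPathLaw X.P i (ν i)) {h : ℕ → ℝ} (hh : ∀ i, step X h i = (-1) * h i)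
    (h0 : h 0 = 1) {D : Set (ℕ → ℕ)} (hD : MeasurableSet D) (hinv : MInvariant 2 D) :
    ∃ c d : ℝ, ∀ i, (ν i).real D + (ν i).real (pathShift ⁻¹' D) = c ∧
      (ν i).real D - (ν i).real (pathShift ⁻¹' D) = d * h i := by
  have hf : ∀ i, step X (fun j => (ν j).real D) i = (ν i).real (pathShift ⁻¹' D) := fun i =>
    (real_preimage_pathShift hbd hν hD i).symm
  have hg : ∀ i, step X (fun j => (ν j).real (pathShift ⁻¹' D)) i = (ν i).real D := fun i => by
    rw [← real_preimage_pathShift hbd hν (measurable_pathShift hD)]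
    congr 1
    ext ω
    exact (hinv ω).symm
  have hadd := eigenfunction_unique hbd (c := 1)
    (u := fun i => (ν i).real D + (ν i).real (pathShift ⁻¹' D))
    (v := fun _ => (ν 0).real D + (ν 0).real (pathShift ⁻¹' D))
    (fun i => by rw [step_add, hf, hg]; ring) (fun i => by rw [step_const hbd, one_mul]) rfl
  have hsub := eigenfunction_unique hbd (c := -1)
    (u := fun i => (ν i).real D - (ν i).real (pathShift ⁻¹' D))
    (v := fun i => ((ν 0).real D - (ν 0).real (pathShift ⁻¹' D)) * h i)
    (fun i => by rw [step_sub, hf, hg]; ring)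
    (fun i => by rw [step_const_mul, hh]; ring) (by simp [h0])
  exact ⟨_, _, fun i => ⟨congrFun hadd i, congrFun hsub i⟩⟩

lemma measurableSet_L (m : ℕ) (C : Set ℕ) : MeasurableSet (X.L m C) := by
  have : X.L m C = ⋃ n, ⋂ k, ⋂ _ : n ≤ k, (fun ω : ℕ → ℕ => ω (k * m)) ⁻¹' C := by
    ext ω
    simp [MarkovChain.L]
  rw [this]
  exact .iUnion fun n => .iInter fun k => .iInter fun _ =>
    measurable_pi_apply (k * m) MeasurableSet.of_discrete

lemma mInvariant_L (C : Set ℕ) : MInvariant 2 (X.L 2 C) := by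
  have hs : ∀ ω : ℕ → ℕ, ∀ k, pathShift^[2] ω (k * 2) = ω ((k + 1) * 2) := fun ω k => by
    rw [add_one_mul]; rfl
  intro ω
  simp only [MarkovChain.L, mem_ofPred_eq, hs]
  constructor
  · rintro ⟨n, hn⟩
    exact ⟨n, fun k hk => hn _ (by omega)⟩
  · rintro ⟨n, hn⟩
    refine ⟨n + 1, fun k hk => ?_⟩
    obtain ⟨k, rfl⟩ := Nat.exists_eq_succ_of_ne_zero (by omega : k ≠ 0)
    exact hn k (by omega)

lemma disjoint_L {A B : Set ℕ} (h : Disjoint A B) (m : ℕ) : Disjoint (X.L m A) (X.L m B) := by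
  rw [Set.disjoint_left]
  rintro ω ⟨n, hn⟩ ⟨n', hn'⟩
  exact Set.disjoint_left.1 h (hn (max n n') (le_max_left _ _)) (hn' _ (le_max_right _ _))

lemma measure_L_ne_zero {m : ℕ} {C : Set ℕ} (h : X.AlmostClosed m C) : X.μ (X.L m C) ≠ 0 := by
  intro h0
  refine h.2 (measure_mono_null (t := symmDiff (X.U m C) (X.L m C) ∪ X.L m C) ?_
    (measure_union_null h.1 h0))
  intro ω hω
  by_cases hL : ω ∈ X.L m C
  · exact Or.inr hL
  · exact Or.inl (Or.inl ⟨hω, hL⟩)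

/-- The growth of the sign-adjusted alternating eigenfunction. -/
lemma step_alternating (hbd : X.IsBirthDeath) {h : ℕ → ℝ} (hh : ∀ i, step X h i = (-1) * h i)
    (i : ℕ) : step X (fun j => (-1) ^ j * h j) i = (1 + 2 * X.P i i) * ((-1) ^ i * h i) := by
  have hi := hh i
  cases i with
  | zero =>
    rw [step_zero] at hi ⊢
    linear_combination -hi
  | succ n =>
    rw [step_succ hbd] at hi ⊢
    simp only [pow_succ]
    linear_combination (-1) ^ n * hi

lemma increment_succ (hbd : X.IsBirthDeath) {a : ℕ → ℝ}
    (ha : ∀ i, step X a i = (1 + 2 * X.P i i) * a i) (n : ℕ) :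
    X.P (n + 1) (n + 2) * (a (n + 2) - a (n + 1))
      = X.P (n + 1) n * (a (n + 1) - a n) + 2 * X.P (n + 1) (n + 1) * a (n + 1) := by
  have h1 := ha (n + 1)
  have h2 := step_const hbd 1 (n + 1)
  rw [step_succ hbd] at h1 h2
  linear_combination h1 - a (n + 1) * h2

lemma increment_zero (hbd : X.IsBirthDeath) {a : ℕ → ℝ}
    (ha : ∀ i, step X a i = (1 + 2 * X.P i i) * a i) :
    X.P 0 1 * (a 1 - a 0) = 2 * X.P 0 0 * a 0 := by
  have h1 := ha 0
  have h2 := step_const hbd 1 0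
  rw [step_zero] at h1 h2
  linear_combination h1 - a 0 * h2

lemma one_le_and_le_succ (hbd : X.IsBirthDeath) {a : ℕ → ℝ}
    (ha : ∀ i, step X a i = (1 + 2 * X.P i i) * a i) (h0 : a 0 = 1) (n : ℕ) :
    1 ≤ a n ∧ a n ≤ a (n + 1) := by
  induction n with
  | zero =>
    refine ⟨h0.ge, sub_nonneg.1 (nonneg_of_mul_nonneg_right ?_ (hbd.birth_pos 0))⟩
    have := X.P_nonneg 0 0
    rw [zero_add, increment_zero hbd ha, h0]
    positivity
  | succ n ih =>
    refine ⟨ih.1.trans ih.2, sub_nonneg.1 (nonneg_of_mul_nonneg_right ?_ (hbd.birth_pos (n + 1)))⟩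
    rw [increment_succ hbd ha]
    have h1 := mul_nonneg (hbd.death_pos n).le (sub_nonneg.2 ih.2)
    have h2 := mul_nonneg (X.P_nonneg (n + 1) (n + 1))
      (zero_le_one.trans (ih.1.trans ih.2))
    linarith

lemma exists_lt (hbd : X.IsBirthDeath) {a : ℕ → ℝ}
    (ha : ∀ i, step X a i = (1 + 2 * X.P i i) * a i) (h0 : a 0 = 1) (i : ℕ) :
    ∃ j, a i < a j := by
  have hbase := one_le_and_le_succ hbd ha h0
  obtain ⟨l, hl⟩ := hbd.self_pos
  have hstrict : ∀ n ≥ l, a n < a (n + 1) := by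
    intro n hn
    induction n, hn using Nat.le_induction with
    | base =>
      refine sub_pos.1 (pos_of_mul_pos_right ?_ (hbd.birth_pos l).le)
      have h1 : 0 < X.P l l * a l := mul_pos hl (zero_lt_one.trans_le (hbase l).1)
      cases l with
      | zero => rw [zero_add, increment_zero hbd ha]; linarith
      | succ n =>
        rw [increment_succ hbd ha]
        have := mul_nonneg (hbd.death_pos n).le (sub_nonneg.2 (hbase n).2)
        linarith
    | succ n hn ih =>
      refine sub_pos.1 (pos_of_mul_pos_right ?_ (hbd.birth_pos (n + 1)).le)
      rw [increment_succ hbd ha]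
      have h1 := mul_pos (hbd.death_pos n) (sub_pos.2 ih)
      have h2 := mul_nonneg (X.P_nonneg (n + 1) (n + 1)) (zero_le_one.trans (hbase (n + 1)).1)
      linarith
  exact ⟨max i l + 1, (monotone_nat_of_le_succ (fun n => (hbase n).2) (le_max_left i l)).trans_lt
    (hstrict _ (le_max_right i l))⟩

/-- The event that the parity of the state does not change at time `n`. -/
def parityKept (n : ℕ) : Set (ℕ → ℕ) := {ω | ω n % 2 = ω (n + 1) % 2}

lemma measurableSet_parityKept (n : ℕ) : MeasurableSet (parityKept n) :=
  measurableSet_eq_fun ((measurable_of_countable fun m : ℕ => m % 2).comp (measurable_pi_apply n))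
    ((measurable_of_countable fun m : ℕ => m % 2).comp (measurable_pi_apply (n + 1)))

lemma real_parityKept_zero (hbd : X.IsBirthDeath) {ν : ℕ → Measure (ℕ → ℕ)}
    (hν : ∀ i, IsPathLaw X.P i (ν i)) (i : ℕ) : (ν i).real (parityKept 0) = X.P i i := by
  have hprob := fun i => (hν i).isProb
  have hstart : ∀ j, ∀ᵐ ω ∂(ν j), ω 0 = j := fun j => by
    have h1 : ν j (PiNat.cylinder (fun _ => j) 1) = 1 := by simpa using (hν j).cylinder 0 fun _ => j
    rw [cylinder_one] at h1
    rwa [← mem_ae_iff_prob_eq_one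
      (by simpa [cylinder_one] using measurableSet_cylinder (fun _ => j) 1)] at h1
  have hval : ∀ j, (ν j).real (pathCons i ⁻¹' parityKept 0) = if i % 2 = j % 2 then 1 else 0 := by
    intro j
    split_ifs with h
    · have : pathCons i ⁻¹' parityKept 0 =ᵐ[ν j] univ := by
        rw [eventuallyEq_set]
        filter_upwards [hstart j] with ω hω
        simpa [parityKept, hω] using h
      rw [measureReal_congr this, probReal_univ]
    · have : pathCons i ⁻¹' parityKept 0 =ᵐ[ν j] (∅ : Set (ℕ → ℕ)) := by
        rw [eventuallyEq_set]
        filter_upwards [hstart j] with ω hω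
        simpa [parityKept, hω] using h
      rw [measureReal_congr this, measureReal_empty]
  rw [real_eq_step hbd hν (measurableSet_parityKept 0)]
  simp only [hval]
  cases i with
  | zero => simp [step_zero]
  | succ n =>
    rw [step_succ hbd, if_neg (by omega), if_pos rfl, if_neg (by omega)]
    ring

lemma real_parityKept_succ (hbd : X.IsBirthDeath) {ν : ℕ → Measure (ℕ → ℕ)}
    (hν : ∀ i, IsPathLaw X.P i (ν i)) (n i : ℕ) :
    (ν i).real (parityKept (n + 1)) = step X (fun j => (ν j).real (parityKept n)) i :=
  real_eq_step hbd hν (measurableSet_parityKept (n + 1)) i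

/-- If the sign-adjusted alternating eigenfunction is bounded, then the parity of the state
eventually alternates. -/
lemma ae_eventually_alternating (hbd : X.IsBirthDeath) {ν : ℕ → Measure (ℕ → ℕ)}
    (hν : ∀ i, IsPathLaw X.P i (ν i)) {a : ℕ → ℝ}
    (ha : ∀ i, step X a i = (1 + 2 * X.P i i) * a i) (h0 : a 0 = 1) {A : ℝ} (hA : ∀ n, a n ≤ A)
    (i : ℕ) : ∀ᵐ ω ∂(ν i), ∀ᶠ n in atTop, ω ∉ parityKept n := by
  have hprob := fun i => (hν i).isProb
  have hsum : ∀ n i, ∑ k ∈ Finset.range n, (ν i).real (parityKept k) ≤ 2⁻¹ * (A - a i) := by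
    intro n
    induction n with
    | zero => intro i; have := hA i; simp; linarith
    | succ n ih =>
      intro i
      rw [Finset.sum_range_succ', real_parityKept_zero hbd hν]
      have h1 : ∑ k ∈ Finset.range n, (ν i).real (parityKept (k + 1))
          = step X (fun j => ∑ k ∈ Finset.range n, (ν j).real (parityKept k)) i := by
        have := step_sum (X := X) (Finset.range n) (fun _ => (1 : ℝ))
          (fun k j => (ν j).real (parityKept k)) i
        simp only [one_mul] at this
        rw [this]
        exact Finset.sum_congr rfl fun k _ => real_parityKept_succ hbd hν k i
      have h2 := step_mono (X := X) ih i
      rw [step_const_mul, step_sub, step_const hbd, ha] at h2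
      have h3 := mul_le_mul_of_nonneg_left (one_le_and_le_succ hbd ha h0 i).1 (X.P_nonneg i i)
      rw [h1]
      linarith
  have hs := summable_of_sum_range_le (fun _ => measureReal_nonneg) (fun n => hsum n i)
  refine ae_eventually_notMem ?_
  convert hs.tsum_ofReal_ne_top using 3 with k
  exact (ENNReal.ofReal_toReal (measure_ne_top _ _)).symm

/-- The even states. -/
def evens : Set ℕ := {i | i % 2 = 0}

/-- The odd states. -/
def odds : Set ℕ := {i | i % 2 = 1}

lemma disjoint_evens_odds : Disjoint evens odds :=
  Set.disjoint_left.2 fun i (h : i % 2 = 0) (h' : i % 2 = 1) => by omega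

lemma mem_L_evens_or_odds {ω : ℕ → ℕ} (h : ∀ᶠ n in atTop, ω ∉ parityKept n) :
    (ω ∈ X.L 2 evens ∧ pathShift ω ∈ X.L 2 odds) ∨
      (ω ∈ X.L 2 odds ∧ pathShift ω ∈ X.L 2 evens) := by
  obtain ⟨N, hN⟩ := eventually_atTop.1 h
  simp only [parityKept, mem_ofPred_eq] at hN
  have hpar : ∀ k ≥ N, ω (k * 2) % 2 = ω (N * 2) % 2 ∧ ω (k * 2 + 1) % 2 ≠ ω (N * 2) % 2 := by
    intro k hk
    induction k, hk using Nat.le_induction with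
    | base => exact ⟨rfl, Ne.symm (hN (N * 2) (by omega))⟩
    | succ k hk ih =>
      have h1 := hN (k * 2 + 1) (by omega)
      have h2 := hN (k * 2 + 1 + 1) (by omega)
      rw [show (k + 1) * 2 = k * 2 + 1 + 1 by ring]
      omega
  rcases Nat.mod_two_eq_zero_or_one (ω (N * 2)) with h0 | h0
  · refine Or.inl ⟨⟨N, fun k hk => ?_⟩, ⟨N, fun k hk => ?_⟩⟩
    · exact (hpar k hk).1.trans h0
    · have := (hpar k hk).2
      simp only [odds, mem_ofPred_eq, pathShift_apply]
      omega
  · refine Or.inr ⟨⟨N, fun k hk => ?_⟩, ⟨N, fun k hk => ?_⟩⟩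
    · exact (hpar k hk).1.trans h0
    · have := (hpar k hk).2
      simp only [evens, mem_ofPred_eq, pathShift_apply]
      omega

/-- If the alternating eigenfunction is bounded, both parity classes are asymptotically visited
with positive probability. -/
lemma measure_L_parity_ne_zero (hbd : X.IsBirthDeath) {ν : ℕ → Measure (ℕ → ℕ)}
    (hν : ∀ i, IsPathLaw X.P i (ν i)) {h : ℕ → ℝ} (hh : ∀ i, step X h i = (-1) * h i)
    (h0 : h 0 = 1) {A : ℝ} (hA : ∀ n, (-1) ^ n * h n ≤ A) :
    X.μ (X.L 2 evens) ≠ 0 ∧ X.μ (X.L 2 odds) ≠ 0 := by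
  have hprob := fun i => (hν i).isProb
  have ha := step_alternating hbd hh
  have ha0 : (-1 : ℝ) ^ 0 * h 0 = 1 := by simp [h0]
  have hae := ae_eventually_alternating hbd hν ha ha0 hA
  have habs : ∀ i, |h i| = (-1) ^ i * h i := fun i => by
    have := (one_le_and_le_succ hbd ha ha0 i).1
    rw [← abs_of_nonneg (zero_le_one.trans this), abs_mul, abs_pow]
    simp
  have hdisj := Set.disjoint_left.1 (disjoint_L (X := X) disjoint_evens_odds 2)
  have hcompl : ∀ i, (ν i).real (X.L 2 odds) = 1 - (ν i).real (X.L 2 evens) := fun i => by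
    rw [← probReal_compl_eq_one_sub (measurableSet_L 2 evens)]
    refine measureReal_congr ?_
    filter_upwards [hae i] with ω hω
    have h1 := mem_L_evens_or_odds (X := X) hω
    have h2 : ω ∈ X.L 2 evens → ω ∉ X.L 2 odds := fun h => hdisj h
    apply propext
    change ω ∈ X.L 2 odds ↔ ω ∉ X.L 2 evens
    tauto
  have hshift : ∀ i, (ν i).real (pathShift ⁻¹' X.L 2 evens) = (ν i).real (X.L 2 odds) := fun i => by
    refine measureReal_congr ?_
    filter_upwards [hae i] with ω hω
    have h1 := mem_L_evens_or_odds (X := X) hω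
    have h2 : ω ∈ X.L 2 evens → ω ∉ X.L 2 odds := fun h => hdisj h
    have h3 : pathShift ω ∈ X.L 2 evens → pathShift ω ∉ X.L 2 odds := fun h => hdisj h
    apply propext
    change pathShift ω ∈ X.L 2 evens ↔ ω ∈ X.L 2 odds
    tauto
  obtain ⟨c, d, hcd⟩ := real_invariant_eq hbd hν hh h0 (measurableSet_L 2 evens) (mInvariant_L evens)
  have hd : ∀ i, |2 * (ν i).real (X.L 2 evens) - 1| = |d| * |h i| := fun i => by
    rw [← abs_mul, ← (hcd i).2, hshift, hcompl]
    ring_nf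
  have hlt : ∀ i, |2 * (ν i).real (X.L 2 evens) - 1| ≠ 1 := fun i hi => by
    obtain ⟨j, hj⟩ := exists_lt hbd ha ha0 i
    have h1 : |2 * (ν j).real (X.L 2 evens) - 1| ≤ 1 := by
      have h2 : (ν j).real (X.L 2 evens) ≤ 1 := measureReal_le_one
      have h3 : 0 ≤ (ν j).real (X.L 2 evens) := measureReal_nonneg
      rw [abs_le]
      constructor <;> linarith
    simp only [← habs] at hj
    rw [hd] at hi h1
    have hdpos : 0 < |d| := by
      refine (abs_nonneg d).lt_of_ne fun h2 => ?_
      rw [← h2, zero_mul] at hi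
      exact zero_ne_one hi
    have := mul_lt_mul_of_pos_left hj hdpos
    linarith
  obtain ⟨i, hi⟩ := exists_init_pos X
  constructor <;> intro hz <;> refine hlt i ?_ <;>
    have hz' := (measureReal_eq_zero_iff).2 ((measure_eq_zero_iff hν _).1 hz i hi)
  · simp [hz']
  · rw [hcompl] at hz'
    rw [show (ν i).real (X.L 2 evens) = 1 by linarith]
    norm_num

/-- The number of disjoint almost closed sets is bounded by the dimension of a space containing
the probabilities of all invariant events. -/
lemma card_le_of_mem_span (hbd : X.IsBirthDeath) {ν : ℕ → Measure (ℕ → ℕ)}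
    (hν : ∀ i, IsPathLaw X.P i (ν i)) (w : Finset (ℕ → ℝ))
    (hw : ∀ D, MeasurableSet D → MInvariant 2 D →
      (fun i => (ν i).real D) ∈ Submodule.span ℝ (w : Set (ℕ → ℝ)))
    {n : ℕ} (C : Fin n → Set ℕ) (hdisj : Pairwise fun k l => Disjoint (C k) (C l))
    (hpos : ∀ k, X.μ (X.L 2 (C k)) ≠ 0) : n ≤ w.card := by
  have hli := linearIndependent_real hbd hν (D := fun k => X.L 2 (C k))
    (fun k => measurableSet_L 2 (C k)) (fun k => mInvariant_L (C k))
    (fun k l hkl => disjoint_L (hdisj hkl) 2) hpos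
  have := linearIndependent_le_span_aux' _ hli (w : Set (ℕ → ℝ)) (by
    rintro _ ⟨k, rfl⟩
    exact hw _ (measurableSet_L 2 (C k)) (mInvariant_L (C k)))
  simpa using this

lemma beta_eq_one_iff (m : ℕ) : X.beta m = 1 ↔ ∃ C, X.IsBlackwell m {C} := by
  constructor
  · intro h
    have hne : (Set.encard '' {𝒞 : Set (Set ℕ) | X.IsBlackwell m 𝒞}).Nonempty := by
      by_contra hne
      rw [not_nonempty_iff_eq_empty] at hne
      simp [MarkovChain.beta, hne] at h
    obtain ⟨𝒞, h𝒞, hcard⟩ := csInf_mem hne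
    obtain ⟨C, rfl⟩ := encard_eq_one.1 (hcard.trans h)
    exact ⟨C, h𝒞⟩
  · rintro ⟨C, hC⟩
    refine le_antisymm (sInf_le ⟨{C}, hC, encard_singleton C⟩) (le_sInf ?_)
    rintro _ ⟨𝒞, h𝒞, rfl⟩
    rw [one_le_encard_iff_nonempty]
    by_contra hne
    rw [not_nonempty_iff_eq_empty] at hne
    subst hne
    simpa using MarkovChain.IsBlackwell.sum_L_eq_one h𝒞

lemma isBlackwell_univ {m : ℕ} (h : X.Atomic m univ) : X.IsBlackwell m {univ} where
  countable := countable_singleton _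
  almostClosed := by rintro _ rfl; exact h.1
  disjoint := pairwiseDisjoint_singleton _ _
  atMostOneNonatomic := by rintro _ rfl _ rfl _ _; rfl
  nonatomicNoAtomicSubset := by rintro _ rfl hn; exact (hn h).elim
  nonatomicTransientStates := by rintro _ rfl hn; exact (hn h).elim
  sum_L_eq_one := by
    have := X.μ_prob
    have hL : X.L m univ = univ := eq_univ_of_forall fun ω => ⟨0, fun _ _ => mem_univ _⟩
    rw [tsum_singleton univ fun C => X.μ (X.L m C), hL, measure_univ]

lemma almostClosed_univ (m : ℕ) : X.AlmostClosed m univ := by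
  have := X.μ_prob
  have hL : X.L m univ = univ := eq_univ_of_forall fun ω => ⟨0, fun _ _ => mem_univ _⟩
  have hU : X.U m univ = univ := eq_univ_of_forall fun ω n => ⟨n, le_rfl, mem_univ _⟩
  constructor
  · simp [MarkovChain.Regular, hL, hU]
  · simp [MarkovChain.Transient, hU]

/-- If the alternating eigenfunction is unbounded, the whole state space is atomic. -/
lemma atomic_univ (hbd : X.IsBirthDeath) {h : ℕ → ℝ} (hh : ∀ i, step X h i = (-1) * h i)
    (h0 : h 0 = 1) (hunb : ∀ A, ∃ n, A < |h n|) : X.Atomic 2 univ := by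
  choose ν hν using exists_isPathLaw hbd
  have hprob := fun i => (hν i).isProb
  refine ⟨almostClosed_univ 2, ?_⟩
  rintro ⟨A, B, -, -, hAB, hA, hB⟩
  have := card_le_of_mem_span hbd hν {fun _ => 1} (fun D hD hinv => ?_) ![A, B] (fun k l hkl => ?_)
    (fun k => ?_)
  · simp at this
  · obtain ⟨c, d, hcd⟩ := real_invariant_eq hbd hν hh h0 hD hinv
    have hbound : ∀ i, |d| * |h i| ≤ 1 := fun i => by
      rw [← abs_mul, ← (hcd i).2, abs_le]
      have h1 : (ν i).real D ≤ 1 := measureReal_le_one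
      have h2 : 0 ≤ (ν i).real D := measureReal_nonneg
      have h3 : (ν i).real (pathShift ⁻¹' D) ≤ 1 := measureReal_le_one
      have h4 : 0 ≤ (ν i).real (pathShift ⁻¹' D) := measureReal_nonneg
      constructor <;> linarith
    have hd : d = 0 := by
      by_contra hd
      have hdpos := abs_pos.2 hd
      obtain ⟨n, hn⟩ := hunb |d|⁻¹
      have := mul_lt_mul_of_pos_left hn hdpos
      rw [mul_inv_cancel₀ hdpos.ne'] at this
      exact (hbound n).not_gt this
    rw [Finset.coe_singleton, Submodule.mem_span_singleton]
    refine ⟨c / 2, funext fun i => ?_⟩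
    have := hcd i
    rw [hd] at this
    simp only [Pi.smul_apply, smul_eq_mul]
    linarith
  · fin_cases k <;> fin_cases l <;> simp_all [hAB.symm]
  · fin_cases k
    · exact measure_L_ne_zero hA
    · exact measure_L_ne_zero hB

/-- If the alternating eigenfunction is bounded, no single set is a Blackwell decomposition. -/
lemma not_isBlackwell_singleton (hbd : X.IsBirthDeath) {h : ℕ → ℝ}
    (hh : ∀ i, step X h i = (-1) * h i) (h0 : h 0 = 1) {A : ℝ} (hA : ∀ n, (-1) ^ n * h n ≤ A)
    (C : Set ℕ) : ¬ X.IsBlackwell 2 {C} := by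
  classical
  intro hC
  have := X.μ_prob
  choose ν hν using exists_isPathLaw hbd
  obtain ⟨hE, hO⟩ := measure_L_parity_ne_zero hbd hν hh h0 hA
  have hparity : ∀ᵐ ω ∂X.μ, ω ∈ X.L 2 evens ∨ ω ∈ X.L 2 odds := by
    rw [ae_iff, measure_eq_zero_iff hν]
    intro i _
    rw [← ae_iff]
    filter_upwards [ae_eventually_alternating hbd hν (step_alternating hbd hh) (by simp [h0]) hA i]
      with ω hω
    exact (mem_L_evens_or_odds hω).imp And.left And.left
  have hCL : ∀ᵐ ω ∂X.μ, ω ∈ X.L 2 C := by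
    have h1 := hC.sum_L_eq_one
    rw [tsum_singleton C fun C => X.μ (X.L 2 C)] at h1
    exact (mem_ae_iff_prob_eq_one (measurableSet_L 2 C)).2 h1
  have hinter : ∀ E O : Set ℕ, Disjoint E O → X.μ (X.L 2 E) ≠ 0 →
      (∀ᵐ ω ∂X.μ, ω ∈ X.L 2 E ∨ ω ∈ X.L 2 O) → X.AlmostClosed 2 (C ∩ E) := by
    intro E O hEO hpos hae
    have hL : ∀ ω, ω ∈ X.L 2 C → ω ∈ X.L 2 E → ω ∈ X.L 2 (C ∩ E) := by
      rintro ω ⟨n, hn⟩ ⟨n', hn'⟩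
      exact ⟨max n n', fun k hk => ⟨hn k (le_of_max_le_left hk), hn' k (le_of_max_le_right hk)⟩⟩
    have hLU : ∀ ω, ω ∈ X.L 2 (C ∩ E) → ω ∈ X.U 2 (C ∩ E) := by
      rintro ω ⟨n, hn⟩ k
      exact ⟨max n k, le_max_right _ _, hn _ (le_max_left _ _)⟩
    constructor
    · rw [MarkovChain.Regular, measure_symmDiff_eq_zero_iff, eventuallyEq_set]
      filter_upwards [hCL, hae] with ω h1 h2
      refine ⟨fun hU => hL ω h1 (h2.resolve_right ?_), hLU ω⟩
      rintro ⟨n, hn⟩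
      obtain ⟨k, hk, hkE⟩ := hU n
      exact Set.disjoint_left.1 hEO hkE.2 (hn k hk)
    · intro h1
      refine hpos (measure_mono_null_ae ?_ h1)
      filter_upwards [hCL] with ω h1 h2
      exact hLU ω (hL ω h1 h2)
  have hCE := hinter evens odds disjoint_evens_odds hE hparity
  have hCO := hinter odds evens disjoint_evens_odds.symm hO (hparity.mono fun ω => Or.symm)
  have hnotAtomic : ¬ X.Atomic 2 C := fun hat => hat.2 ⟨C ∩ evens, C ∩ odds, inter_subset_left,
    inter_subset_left, disjoint_evens_odds.mono inter_subset_right inter_subset_right, hCE, hCO⟩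
  refine hC.nonatomicNoAtomicSubset C rfl hnotAtomic (C ∩ evens) inter_subset_left ⟨hCE, ?_⟩
  rintro ⟨A, B, hAC, hBC, hAB, hA, hB⟩
  have hAO : Disjoint A odds := disjoint_evens_odds.mono_left (hAC.trans inter_subset_right)
  have hBO : Disjoint B odds := disjoint_evens_odds.mono_left (hBC.trans inter_subset_right)
  have := card_le_of_mem_span hbd hν {fun _ => 1, h} (fun D hD hinv => ?_) ![A, B, odds]
    (fun k l hkl => ?_) (fun k => ?_)
  · exact absurd (this.trans Finset.card_le_two) (by norm_num)
  · obtain ⟨c, d, hcd⟩ := real_invariant_eq hbd hν hh h0 hD hinv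
    rw [Finset.coe_pair, Submodule.mem_span_pair]
    refine ⟨c / 2, d / 2, funext fun i => ?_⟩
    have := hcd i
    simp only [Pi.add_apply, Pi.smul_apply, smul_eq_mul]
    linarith
  · fin_cases k <;> fin_cases l <;> simp_all [hAB.symm, hAO.symm, hBO.symm]
  · fin_cases k
    · exact measure_L_ne_zero hA
    · exact measure_L_ne_zero hB
    · exact hO

end BirthDeath

/-- For a birth-death process `X`, the 2-step chain `X^(2)` is
simple if and only if `|Q_n(-1)| → ∞` as `n → ∞`, where the `Q_n` are the
birth-death polynomials of `X`. -/
theorem stmt17 (X : MarkovChain ℕ) (hbd : X.IsBirthDeath)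
    (hirr : X.Irreducible) (hap : X.Aperiodic)
    (Q : ℕ → ℝ → ℝ)
    (hQ0 : ∀ x : ℝ, Q 0 x = 1)
    (hQ1 : ∀ x : ℝ, X.P 0 1 * Q 1 x = x - X.P 0 0)
    (hQrec : ∀ n : ℕ, 1 ≤ n → ∀ x : ℝ,
      x * Q n x = X.P n (n - 1) * Q (n - 1) x + X.P n n * Q n x
        + X.P n (n + 1) * Q (n + 1) x) :
    X.beta 2 = 1 ↔ Tendsto (fun n => |Q n (-1)|) atTop atTop := by
  let h : ℕ → ℝ := fun n => Q n (-1)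
  have h0 : h 0 = 1 := hQ0 _
  have hh : ∀ i, BirthDeath.step X h i = (-1) * h i := by
    intro i
    cases i with
    | zero =>
      rw [BirthDeath.step_zero, h0]
      linarith [hQ1 (-1)]
    | succ n =>
      rw [BirthDeath.step_succ hbd]
      exact (hQrec (n + 1) n.succ_pos (-1)).symm
  have ha := BirthDeath.one_le_and_le_succ hbd (BirthDeath.step_alternating hbd hh) (by simp [h0])
  have habs : ∀ n, |h n| = (-1) ^ n * h n := fun n => by
    rw [← abs_of_nonneg (zero_le_one.trans (ha n).1), abs_mul, abs_pow]
    simp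
  rw [BirthDeath.beta_eq_one_iff]
  constructor
  · rintro ⟨C, hC⟩
    refine tendsto_atTop_atTop_of_monotone
      (monotone_nat_of_le_succ fun n =>
        (habs n).trans_le ((ha n).2.trans_eq (habs (n + 1)).symm)) fun A => ?_
    by_contra! hA
    exact BirthDeath.not_isBlackwell_singleton hbd hh h0
      (fun n => (habs n).symm.trans_le (hA n).le) C hC
  · intro hlim
    exact ⟨univ, BirthDeath.isBlackwell_univ (BirthDeath.atomic_univ hbd hh h0 fun A =>
      (hlim.eventually_gt_atTop A).exists)⟩
end

section
/- For a birth-death process, the sequence {(−1)^n Q_n(−1)}_{n≥0} is increasing, and strictly increasing for all sufficiently large n. Moreover, (−1)^n Q_n(−1) → ∞ as n → ∞ if and only if Σ_{j=0}^∞ (1/(p_j π_j)) Σ_{k=0}^j r_k π_k = ∞. -/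
open MeasureTheory Filter Set ProbabilityTheory

/-- A sequence whose increments are `w n` times its partial sums weighted by `c ≥ 0` is
at least one. -/
theorem one_le_of_increments {a w c : ℕ → ℝ} (h0 : a 0 = 1) (hw : ∀ n, 0 < w n)
    (hc : ∀ n, 0 ≤ c n)
    (ha : ∀ n, a (n + 1) - a n = w n * ∑ k ∈ Finset.range (n + 1), c k * a k) (n : ℕ) :
    1 ≤ a n := by
  induction n using Nat.strong_induction_on with
  | _ n ih =>
    cases n with
    | zero => exact h0.ge
    | succ n =>
      have hsum : 0 ≤ ∑ k ∈ Finset.range (n + 1), c k * a k :=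
        Finset.sum_nonneg fun k hk =>
          mul_nonneg (hc k) (zero_le_one.trans (ih k (Finset.mem_range.mp hk)))
      have := mul_nonneg (hw n).le hsum
      linarith [ha n, ih n n.lt_succ_self]

theorem monotone_of_increments {a w c : ℕ → ℝ} (h0 : a 0 = 1) (hw : ∀ n, 0 < w n)
    (hc : ∀ n, 0 ≤ c n)
    (ha : ∀ n, a (n + 1) - a n = w n * ∑ k ∈ Finset.range (n + 1), c k * a k) :
    Monotone a := by
  refine monotone_nat_of_le_succ fun n => ?_
  rw [← sub_nonneg, ha n]
  exact mul_nonneg (hw n).le <| Finset.sum_nonneg fun k _ =>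
    mul_nonneg (hc k) (zero_le_one.trans (one_le_of_increments h0 hw hc ha k))

theorem lt_succ_of_increments {a w c : ℕ → ℝ} (h0 : a 0 = 1) (hw : ∀ n, 0 < w n)
    (hc : ∀ n, 0 ≤ c n)
    (ha : ∀ n, a (n + 1) - a n = w n * ∑ k ∈ Finset.range (n + 1), c k * a k)
    {i n : ℕ} (hi : 0 < c i) (hin : i ≤ n) : a n < a (n + 1) := by
  have hpos : ∀ k, 0 < a k := fun k =>
    zero_lt_one.trans_le (one_le_of_increments h0 hw hc ha k)
  rw [← sub_pos, ha n]
  exact mul_pos (hw n) <| Finset.sum_pos' (fun k _ => mul_nonneg (hc k) (hpos k).le)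
    ⟨i, Finset.mem_range.mpr (Nat.lt_succ_of_le hin), mul_pos hi (hpos i)⟩

theorem one_add_sum_le_of_increments {a w c : ℕ → ℝ} (h0 : a 0 = 1) (hw : ∀ n, 0 < w n)
    (hc : ∀ n, 0 ≤ c n)
    (ha : ∀ n, a (n + 1) - a n = w n * ∑ k ∈ Finset.range (n + 1), c k * a k) (n : ℕ) :
    1 + ∑ j ∈ Finset.range n, w j * ∑ k ∈ Finset.range (j + 1), c k ≤ a n := by
  induction n with
  | zero => simp [h0]
  | succ n ih =>
    have hle : w n * ∑ k ∈ Finset.range (n + 1), c k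
        ≤ w n * ∑ k ∈ Finset.range (n + 1), c k * a k :=
      mul_le_mul_of_nonneg_left (Finset.sum_le_sum fun k _ =>
        le_mul_of_one_le_right (hc k) (one_le_of_increments h0 hw hc ha k)) (hw n).le
    rw [Finset.sum_range_succ]
    linarith [ha n]

theorem le_exp_sum_of_increments {a w c : ℕ → ℝ} (h0 : a 0 = 1) (hw : ∀ n, 0 < w n)
    (hc : ∀ n, 0 ≤ c n)
    (ha : ∀ n, a (n + 1) - a n = w n * ∑ k ∈ Finset.range (n + 1), c k * a k) (n : ℕ) :
    a n ≤ Real.exp (∑ j ∈ Finset.range n, w j * ∑ k ∈ Finset.range (j + 1), c k) := by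
  induction n with
  | zero => simp [h0]
  | succ n ih =>
    set s := w n * ∑ k ∈ Finset.range (n + 1), c k with hs
    have hs0 : 0 ≤ s := mul_nonneg (hw n).le (Finset.sum_nonneg fun k _ => hc k)
    have hle : w n * ∑ k ∈ Finset.range (n + 1), c k * a k ≤ s * a n := by
      rw [hs, mul_assoc, Finset.sum_mul]
      exact mul_le_mul_of_nonneg_left (Finset.sum_le_sum fun k hk =>
        mul_le_mul_of_nonneg_left (monotone_of_increments h0 hw hc ha
          (Nat.lt_succ_iff.mp (Finset.mem_range.mp hk))) (hc k)) (hw n).le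
    rw [Finset.sum_range_succ, ← hs, Real.exp_add]
    calc a (n + 1) ≤ a n * (s + 1) := by linarith [ha n]
      _ ≤ _ := mul_le_mul ih (Real.add_one_le_exp s) (by linarith) (Real.exp_pos _).le

theorem tendsto_atTop_iff_of_increments {a w c : ℕ → ℝ} (h0 : a 0 = 1)
    (hw : ∀ n, 0 < w n) (hc : ∀ n, 0 ≤ c n)
    (ha : ∀ n, a (n + 1) - a n = w n * ∑ k ∈ Finset.range (n + 1), c k * a k) :
    Tendsto a atTop atTop ↔
      Tendsto (fun n => ∑ j ∈ Finset.range n, w j * ∑ k ∈ Finset.range (j + 1), c k)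
        atTop atTop :=
  ⟨fun h => Real.tendsto_exp_comp_atTop.mp
      (tendsto_atTop_mono (le_exp_sum_of_increments h0 hw hc ha) h),
    fun h => tendsto_atTop_mono (one_add_sum_le_of_increments h0 hw hc ha)
      (tendsto_atTop_add_const_left _ 1 h)⟩

/-- For a birth-death process, the sequence `{(-1)^n Q_n(-1)}` is
increasing, strictly increasing for all sufficiently large `n`, and it tends to
`∞` if and only if `Σ_j (1/(p_j π_j)) Σ_{k ≤ j} r_k π_k = ∞`. -/
theorem stmt18 (p q r : ℕ → ℝ)
    (hp : ∀ i : ℕ, 0 < p i) (hq : ∀ i : ℕ, 0 < q (i + 1)) (hq0 : q 0 = 0)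
    (hr : ∀ i : ℕ, 0 ≤ r i) (hpqr : ∀ i : ℕ, p i + q i + r i = 1)
    (hrpos : ∃ i : ℕ, 0 < r i)
    (pi : ℕ → ℝ) (hpi0 : pi 0 = 1)
    (hpi : ∀ n : ℕ, pi (n + 1) = pi n * p n / q (n + 1))
    (Q : ℕ → ℝ → ℝ)
    (hQ0 : ∀ x : ℝ, Q 0 x = 1)
    (hQ1 : ∀ x : ℝ, p 0 * Q 1 x = x - r 0)
    (hQrec : ∀ n : ℕ, 1 ≤ n → ∀ x : ℝ,
      x * Q n x = q n * Q (n - 1) x + r n * Q n x + p n * Q (n + 1) x) :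
    (Monotone fun n : ℕ => (-1 : ℝ) ^ n * Q n (-1)) ∧
    (∃ N : ℕ, ∀ n : ℕ, N ≤ n →
      (-1 : ℝ) ^ n * Q n (-1) < (-1 : ℝ) ^ (n + 1) * Q (n + 1) (-1)) ∧
    (Tendsto (fun n : ℕ => (-1 : ℝ) ^ n * Q n (-1)) atTop atTop ↔
      Tendsto (fun n : ℕ => ∑ j ∈ Finset.range n,
        (1 / (p j * pi j)) * ∑ k ∈ Finset.range (j + 1), r k * pi k)
        atTop atTop) := by
  have hpi_pos : ∀ n, 0 < pi n := by
    intro n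
    induction n with
    | zero => simp [hpi0]
    | succ n ih => rw [hpi n]; exact div_pos (mul_pos ih (hp n)) (hq n)
  set a : ℕ → ℝ := fun n => (-1 : ℝ) ^ n * Q n (-1) with ha_def
  have ha0 : a 0 = 1 := by simp [ha_def, hQ0]
  have hflux : ∀ n, p n * pi n * (a (n + 1) - a n)
      = ∑ k ∈ Finset.range (n + 1), 2 * (r k * pi k) * a k := by
    intro n
    induction n with
    | zero =>
      simp only [ha_def, zero_add, Finset.sum_range_one, hpi0, hQ0, pow_zero, pow_one]
      linear_combination -hQ1 (-1) - hpqr 0 + hq0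
    | succ n ih =>
      rw [Finset.sum_range_succ, ← ih]
      have hbalance : pi (n + 1) * q (n + 1) = pi n * p n := by
        rw [hpi n, div_mul_cancel₀ _ (hq n).ne']
      have hrec := hQrec (n + 1) (Nat.succ_pos n) (-1)
      rw [Nat.add_sub_cancel] at hrec
      simp only [ha_def, pow_succ]
      linear_combination (-1 : ℝ) ^ n * (-pi (n + 1) * hrec
        + pi (n + 1) * Q (n + 1) (-1) * hpqr (n + 1)
        - (Q n (-1) + Q (n + 1) (-1)) * hbalance)
  have hw : ∀ n, 0 < 1 / (p n * pi n) := fun n =>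
    one_div_pos.mpr (mul_pos (hp n) (hpi_pos n))
  have hc : ∀ n, 0 ≤ 2 * (r n * pi n) := fun n =>
    mul_nonneg zero_le_two (mul_nonneg (hr n) (hpi_pos n).le)
  have ha : ∀ n, a (n + 1) - a n
      = 1 / (p n * pi n) * ∑ k ∈ Finset.range (n + 1), 2 * (r k * pi k) * a k := by
    intro n
    rw [← hflux n, ← mul_assoc, one_div_mul_cancel (mul_pos (hp n) (hpi_pos n)).ne', one_mul]
  refine ⟨monotone_of_increments ha0 hw hc ha, ?_, ?_⟩
  · obtain ⟨i, hi⟩ := hrpos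
    exact ⟨i, fun n hn => lt_succ_of_increments ha0 hw hc ha
      (mul_pos two_pos (mul_pos hi (hpi_pos i))) hn⟩
  · rw [tendsto_atTop_iff_of_increments ha0 hw hc ha]
    simp only [← Finset.mul_sum, mul_left_comm _ (2 : ℝ)]
    exact tendsto_const_mul_atTop_of_pos two_pos
end
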